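/- arXiv:2010.12524 — 2 statements merged into one kernel-verified Lean document; each statement's English description precedes it below -/
import Mathlib

section
/- There exists a constant C ≥ 1, depending only on n and Λ, with the following property. For every solution φ, every x₀ and every s ∈ (0,1) with B_s(x₀) ⊆ B₁, one has the oscillation decay osc_{B_{s/2}(x₀)} φ ≤ ((C e^{4Λκ} − 1)/(C e^{4Λκ} + 1)) · osc_{B_s(x₀)} φ + e^{κ} s², where for a set E, osc_E φ := sup_E φ − inf_E φ. -/
open MeasureTheory Metric Real Set

/-- A (weak) solution of the quasilinear elliptic equation
`-∂ⱼ(aᵢⱼ(x,φ)∂ᵢφ) = ρ(x,φ)[1 - (1/2) f e^φ + F(x,φ,∇φ)]` on the unit ball `B₁ ⊆ ℝⁿ`,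
which is continuously differentiable and satisfies `0 ≤ φ ≤ κ`. -/
def IsSolution (n : ℕ) (κ : ℝ)
    (a : Fin n → Fin n → EuclideanSpace ℝ (Fin n) → ℝ → ℝ)
    (ρ : EuclideanSpace ℝ (Fin n) → ℝ → ℝ)
    (f : EuclideanSpace ℝ (Fin n) → ℝ)
    (F : EuclideanSpace ℝ (Fin n) → ℝ → EuclideanSpace ℝ (Fin n) → ℝ)
    (φ : EuclideanSpace ℝ (Fin n) → ℝ) : Prop :=
  ContDiffOn ℝ 1 φ (ball (0 : EuclideanSpace ℝ (Fin n)) 1) ∧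
  (∀ x ∈ ball (0 : EuclideanSpace ℝ (Fin n)) 1, 0 ≤ φ x ∧ φ x ≤ κ) ∧
  ∀ ψ : EuclideanSpace ℝ (Fin n) → ℝ,
    ContDiff ℝ (⊤ : ℕ∞) ψ → HasCompactSupport ψ →
    tsupport ψ ⊆ ball (0 : EuclideanSpace ℝ (Fin n)) 1 →
    (∫ x in ball (0 : EuclideanSpace ℝ (Fin n)) 1,
        ∑ i : Fin n, ∑ j : Fin n,
          a i j x (φ x) * fderiv ℝ φ x (EuclideanSpace.single i 1) *
            fderiv ℝ ψ x (EuclideanSpace.single j 1))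
      = ∫ x in ball (0 : EuclideanSpace ℝ (Fin n)) 1,
          ρ x (φ x) * (1 - (1/2) * f x * Real.exp (φ x) + F x (φ x) (gradient φ x)) * ψ x

/-- Structural assumptions on the coefficients: symmetry and `Λ`-ellipticity of `aᵢⱼ`,
`1/2 ≤ ρ ≤ 2`, `0 ≤ f ≤ 1`, the natural growth bound `|F(x,z,p)| ≤ |p|² + 1`,
and continuity of all coefficients. -/
def GoodCoeffs (n : ℕ) (Λ : ℝ)
    (a : Fin n → Fin n → EuclideanSpace ℝ (Fin n) → ℝ → ℝ)
    (ρ : EuclideanSpace ℝ (Fin n) → ℝ → ℝ)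
    (f : EuclideanSpace ℝ (Fin n) → ℝ)
    (F : EuclideanSpace ℝ (Fin n) → ℝ → EuclideanSpace ℝ (Fin n) → ℝ) : Prop :=
  (∀ i j, ContinuousOn (fun p : EuclideanSpace ℝ (Fin n) × ℝ => a i j p.1 p.2)
      ((ball (0 : EuclideanSpace ℝ (Fin n)) 1) ×ˢ (Set.univ : Set ℝ))) ∧
  (∀ i j x z, a i j x z = a j i x z) ∧
  (∀ x ∈ ball (0 : EuclideanSpace ℝ (Fin n)) 1, ∀ z : ℝ, ∀ ξ : EuclideanSpace ℝ (Fin n),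
      Λ⁻¹ * ‖ξ‖ ^ 2 ≤ ∑ i : Fin n, ∑ j : Fin n, a i j x z * ξ i * ξ j ∧
      ∑ i : Fin n, ∑ j : Fin n, a i j x z * ξ i * ξ j ≤ Λ * ‖ξ‖ ^ 2) ∧
  ContinuousOn (fun p : EuclideanSpace ℝ (Fin n) × ℝ => ρ p.1 p.2)
      ((ball (0 : EuclideanSpace ℝ (Fin n)) 1) ×ˢ (Set.univ : Set ℝ)) ∧
  (∀ x ∈ ball (0 : EuclideanSpace ℝ (Fin n)) 1, ∀ z : ℝ, 1/2 ≤ ρ x z ∧ ρ x z ≤ 2) ∧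
  ContinuousOn f (ball (0 : EuclideanSpace ℝ (Fin n)) 1) ∧
  (∀ x ∈ ball (0 : EuclideanSpace ℝ (Fin n)) 1, 0 ≤ f x ∧ f x ≤ 1) ∧
  ContinuousOn (fun p : EuclideanSpace ℝ (Fin n) × ℝ × EuclideanSpace ℝ (Fin n) =>
      F p.1 p.2.1 p.2.2)
      ((ball (0 : EuclideanSpace ℝ (Fin n)) 1) ×ˢ
        (Set.univ : Set (ℝ × EuclideanSpace ℝ (Fin n)))) ∧
  (∀ x ∈ ball (0 : EuclideanSpace ℝ (Fin n)) 1, ∀ (z : ℝ) (p : EuclideanSpace ℝ (Fin n)),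
      |F x z p| ≤ ‖p‖ ^ 2 + 1)

section Helpers

set_option maxSynthPendingDepth 3
set_option linter.deprecated false

abbrev EE (n : ℕ) := EuclideanSpace ℝ (Fin n)
abbrev DD (n : ℕ) := EuclideanSpace ℝ (Fin n) →L[ℝ] ℝ

/-- The `C¹` function `t ↦ (t₊)²`. -/
noncomputable def sqp (t : ℝ) : ℝ := (max t 0) ^ 2

theorem sqp_nonneg (t : ℝ) : 0 ≤ sqp t := sq_nonneg _

theorem sqp_of_nonpos {t : ℝ} (h : t ≤ 0) : sqp t = 0 := by simp [sqp, max_eq_right h]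

theorem sqp_of_nonneg {t : ℝ} (h : 0 ≤ t) : sqp t = t ^ 2 := by simp [sqp, max_eq_left h]

theorem hasDerivAt_sqp (t : ℝ) : HasDerivAt sqp (2 * max t 0) t := by
  rcases lt_trichotomy t 0 with h | h | h
  · rw [max_eq_right h.le]
    have : HasDerivAt (fun _ : ℝ => (0:ℝ)) 0 t := hasDerivAt_const _ _
    simp only [mul_zero]
    refine this.congr_of_eventuallyEq ?_
    filter_upwards [Iio_mem_nhds h] with x hx using sqp_of_nonpos (le_of_lt hx)
  · subst h
    simp only [max_self, mul_zero]
    rw [hasDerivAt_iff_isLittleO_nhds_zero]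
    have h2 : (fun h : ℝ => h ^ 2) =o[nhds 0] fun h => h := by
      simpa using Asymptotics.isLittleO_pow_id (𝕜 := ℝ) (n := 2) (by norm_num)
    refine Asymptotics.IsBigO.trans_isLittleO ?_ h2
    refine Asymptotics.IsBigO.of_bound 1 (Filter.Eventually.of_forall fun x => ?_)
    simp only [zero_add, smul_zero, sub_zero, one_mul, sqp_of_nonpos le_rfl, Real.norm_eq_abs]
    rw [abs_of_nonneg (sqp_nonneg x), abs_of_nonneg (sq_nonneg x)]
    rcases le_total x 0 with h | h
    · rw [sqp_of_nonpos h]; positivity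
    · rw [sqp_of_nonneg h]
  · rw [max_eq_left h.le]
    have : HasDerivAt (fun t : ℝ => t ^ 2) (2 * t) t := by simpa using hasDerivAt_pow 2 t
    refine this.congr_of_eventuallyEq ?_
    filter_upwards [Ioi_mem_nhds h] with x hx using sqp_of_nonneg (le_of_lt hx)

theorem deriv_sqp : deriv sqp = fun t => 2 * max t 0 := funext fun t => (hasDerivAt_sqp t).deriv

theorem contDiff_sqp : ContDiff ℝ 1 sqp := by
  rw [contDiff_one_iff_deriv, deriv_sqp]
  exact ⟨fun t => (hasDerivAt_sqp t).differentiableAt, by fun_prop⟩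

/-- C^1 cut-off with support in `closedBall 0 r`. -/
noncomputable def cut {n : ℕ} (L r : ℝ) (x : EE n) : ℝ := sqp (L * (r ^ 2 - ‖x‖ ^ 2))

theorem contDiff_cut {n : ℕ} (L r : ℝ) : ContDiff ℝ 1 (cut L r : EE n → ℝ) := by
  unfold cut
  exact contDiff_sqp.comp (contDiff_const.mul (contDiff_const.sub ((contDiff_norm_sq ℝ))))

theorem cut_nonneg {n : ℕ} (L r : ℝ) (x : EE n) : 0 ≤ cut L r x := sqp_nonneg _

theorem cut_eq_zero {n : ℕ} {L r : ℝ} (hL : 0 ≤ L) (hr : 0 ≤ r) {x : EE n} (hx : r ≤ ‖x‖) :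
    cut L r x = 0 := by
  apply sqp_of_nonpos
  apply mul_nonpos_of_nonneg_of_nonpos hL
  nlinarith

theorem fderiv_cut {n : ℕ} (L r : ℝ) (x : EE n) : fderiv ℝ (cut L r : EE n → ℝ) x =
    (2 * max (L * (r ^ 2 - ‖x‖ ^ 2)) 0) • (L • (-(2 • innerSL ℝ x))) := by
  have h1 : HasFDerivAt (fun x : EE n => ‖x‖ ^ 2) (2 • innerSL ℝ x) x :=
    (hasStrictFDerivAt_norm_sq x).hasFDerivAt
  have h2 := ((h1.const_sub (r ^ 2)).const_mul L)
  exact ((hasDerivAt_sqp _).comp_hasFDerivAt x h2).fderiv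

theorem fderiv_cut_eq_zero {n : ℕ} {L r : ℝ} (hL : 0 ≤ L) (hr : 0 ≤ r) {x : EE n} (hx : r ≤ ‖x‖) :
    fderiv ℝ (cut L r : EE n → ℝ) x = 0 := by
  rw [fderiv_cut, max_eq_right]
  · simp
  · apply mul_nonpos_of_nonneg_of_nonpos hL
    nlinarith

theorem cut_le {n : ℕ} {L r : ℝ} (hL : 0 ≤ L) (hr : 0 ≤ r) (hr1 : r ≤ 1) (x : EE n) :
    cut L r x ≤ L ^ 2 := by
  have h := norm_nonneg x
  rcases le_total r ‖x‖ with hx | hx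
  · rw [cut_eq_zero hL hr hx]; positivity
  · have h0 : 0 ≤ r ^ 2 - ‖x‖ ^ 2 := by nlinarith
    have h1 : r ^ 2 - ‖x‖ ^ 2 ≤ 1 := by nlinarith
    rw [cut, sqp_of_nonneg (mul_nonneg hL h0), mul_pow]
    have : (r ^ 2 - ‖x‖ ^ 2) ^ 2 ≤ 1 := by nlinarith
    nlinarith [sq_nonneg L]

theorem norm_fderiv_cut_le {n : ℕ} {L r : ℝ} (hL : 0 ≤ L) (hr : 0 ≤ r) (hr1 : r ≤ 1) (x : EE n) :
    ‖fderiv ℝ (cut L r : EE n → ℝ) x‖ ≤ 4 * L ^ 2 := by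
  have h := norm_nonneg x
  rcases le_total r ‖x‖ with hx | hx
  · rw [fderiv_cut_eq_zero hL hr hx]; simp; positivity
  · have h0 : 0 ≤ r ^ 2 - ‖x‖ ^ 2 := by nlinarith
    have h1 : r ^ 2 - ‖x‖ ^ 2 ≤ 1 := by nlinarith
    rw [fderiv_cut, max_eq_left (mul_nonneg hL h0), norm_smul, norm_smul, norm_neg, ← Nat.cast_smul_eq_nsmul ℝ,
      norm_smul, innerSL_apply_norm, Real.norm_of_nonneg (by positivity), Real.norm_of_nonneg hL]
    simp only [Nat.cast_ofNat, Real.norm_ofNat]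
    have : (r ^ 2 - ‖x‖ ^ 2) * ‖x‖ ≤ 1 := by nlinarith
    nlinarith [sq_nonneg L]

theorem one_le_cut {n : ℕ} {L r r' : ℝ} (hL : 0 ≤ L) (h : 1 ≤ L * (r ^ 2 - r' ^ 2))
    {x : EE n} (hx : ‖x‖ ≤ r') : 1 ≤ cut L r x := by
  have h0 := norm_nonneg x
  have : 1 ≤ L * (r ^ 2 - ‖x‖ ^ 2) := by
    refine h.trans (mul_le_mul_of_nonneg_left ?_ hL)
    nlinarith
  rw [cut, sqp_of_nonneg (by linarith)]
  nlinarith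

theorem tsupport_cut {n : ℕ} {L r : ℝ} (hL : 0 ≤ L) (hr : 0 ≤ r) :
    tsupport (cut L r : EE n → ℝ) ⊆ closedBall 0 r := by
  refine closure_minimal (fun x hx => ?_) isClosed_closedBall
  simp only [mem_closedBall, dist_zero_right]
  by_contra hc
  exact hx (cut_eq_zero hL hr (not_le.mp hc).le)

theorem hasCompactSupport_cut {n : ℕ} {L r : ℝ} (hL : 0 ≤ L) (hr : 0 ≤ r) :
    HasCompactSupport (cut L r : EE n → ℝ) :=
  (isCompact_closedBall (0 : EE n) r).of_isClosed_subset (isClosed_tsupport _) (tsupport_cut hL hr)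

structure Ell (n : ℕ) (Λ : ℝ) (b : EE n → DD n →L[ℝ] DD n →L[ℝ] ℝ) : Prop where
  cont : Continuous b
  symm : ∀ x p q, b x p q = b x q p
  lower : ∀ x p, Λ⁻¹ * ‖p‖ ^ 2 ≤ b x p p
  upper : ∀ x p, b x p p ≤ Λ * ‖p‖ ^ 2

def SuperSol (n : ℕ) (b : EE n → DD n →L[ℝ] DD n →L[ℝ] ℝ) (w : EE n → ℝ) (δ : ℝ) : Prop :=
  ∀ ζ : EE n → ℝ, ContDiff ℝ 1 ζ → HasCompactSupport ζ → tsupport ζ ⊆ ball 0 (7/8) →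
    (∀ x, 0 ≤ ζ x) → -(δ * ∫ x, ζ x) ≤ ∫ x, b x (fderiv ℝ w x) (fderiv ℝ ζ x)

theorem Ell.young {n : ℕ} {Λ : ℝ} (hΛ : 1 ≤ Λ) {b : EE n → DD n →L[ℝ] DD n →L[ℝ] ℝ}
    (hb : Ell n Λ b) (x : EE n) (p q : DD n) (e : ℝ) :
    -(2 * e * b x p q) ≤ (1/2) * e ^ 2 * b x p p + 2 * b x q q := by
  have h : 0 ≤ b x ((e/2) • p + q) ((e/2) • p + q) :=
    le_trans (by have := inv_pos.mpr (lt_of_lt_of_le one_pos hΛ); positivity) (hb.lower x _)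
  have h2 := hb.symm x q p
  simp only [map_add, map_smul, ContinuousLinearMap.add_apply, ContinuousLinearMap.smul_apply,
    smul_eq_mul] at h
  rw [h2] at h
  linarith

theorem caccioppoli {n : ℕ} {Λ : ℝ} (hΛ : 1 ≤ Λ) {b : EE n → DD n →L[ℝ] DD n →L[ℝ] ℝ}
    (hb : Ell n Λ b) {w : EE n → ℝ} (hw : ContDiff ℝ 1 w) (hw0 : ∀ x, 0 ≤ w x)
    {δ : ℝ} (hδ : 0 < δ) (hs : SuperSol n b w δ) {H : ℝ}
    {z : EE n → ℝ} (hz : z = fun x => H - Real.log (w x + δ))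
    {η : EE n → ℝ} (hη : ContDiff ℝ 1 η) (hηc : HasCompactSupport η)
    (hηs : tsupport η ⊆ ball 0 (7/8)) {G : ℝ → ℝ} (hG : ContDiff ℝ 1 G)
    (hG0 : ∀ t, 0 ≤ G t) (hG1 : ∀ t, 0 ≤ deriv G t) :
    ∫ x, η x ^ 2 * G (z x) * ‖fderiv ℝ z x‖ ^ 2 ≤
      4 * Λ ^ 2 * (∫ x, G (z x) * ‖fderiv ℝ η x‖ ^ 2) + 2 * Λ * ∫ x, η x ^ 2 * G (z x) := by
  have hΛ0 : 0 < Λ := by linarith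
  have hwp : ∀ x, 0 < w x + δ := fun x => by linarith [hw0 x]
  have hwd : ContDiff ℝ 1 (fun x => w x + δ) := hw.add contDiff_const
  have hzC : ContDiff ℝ 1 z := by
    rw [hz]; exact contDiff_const.sub (hwd.log fun x => (hwp x).ne')
  have hDz : ∀ x, HasFDerivAt z (-((w x + δ)⁻¹ • fderiv ℝ w x)) x := by
    intro x
    have h1 : HasFDerivAt (fun x => w x + δ) (fderiv ℝ w x) x :=
      ((hw.differentiable (by norm_num)) x).hasFDerivAt.add_const δ
    have := (h1.log (hwp x).ne').const_sub H
    rw [hz]; exact this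
  have hDw : ∀ x, fderiv ℝ w x = -((w x + δ) • fderiv ℝ z x) := by
    intro x
    rw [(hDz x).fderiv, smul_neg, neg_neg, smul_smul, mul_inv_cancel₀ (hwp x).ne', one_smul]
  set ζ : EE n → ℝ := fun x => η x ^ 2 * (G (z x) * (w x + δ)⁻¹) with hζ
  have hζC : ContDiff ℝ 1 ζ := (hη.pow 2).mul ((hG.comp hzC).mul (hwd.inv fun x => (hwp x).ne'))
  have hη2 : HasCompactSupport (fun x => η x ^ 2) :=
    hηc.comp_left (g := fun t : ℝ => t ^ 2) (by norm_num)
  have hζc : HasCompactSupport ζ := hη2.mul_right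
  have hζs : tsupport ζ ⊆ ball 0 (7/8) := by
    refine (closure_mono ?_).trans hηs
    intro x hx h0
    apply hx
    simp [hζ, h0]
  have hζ0 : ∀ x, 0 ≤ ζ x := fun x =>
    mul_nonneg (sq_nonneg _) (mul_nonneg (hG0 _) (inv_nonneg.mpr (hwp x).le))
  have key := hs ζ hζC hζc hζs hζ0
  have hDζ : ∀ x, fderiv ℝ ζ x = (w x + δ)⁻¹ • ((2 * η x * G (z x)) • fderiv ℝ η x +
      (η x ^ 2 * deriv G (z x) + η x ^ 2 * G (z x)) • fderiv ℝ z x) := by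
    intro x
    have h1 : HasFDerivAt (fun x => w x + δ) (fderiv ℝ w x) x :=
      ((hw.differentiable (by norm_num)) x).hasFDerivAt.add_const δ
    have h2 : HasFDerivAt (fun x => (w x + δ)⁻¹) (-((w x + δ) ^ 2)⁻¹ • fderiv ℝ w x) x :=
      (hasDerivAt_inv (hwp x).ne').comp_hasFDerivAt x h1
    have h3 : HasFDerivAt (fun x => G (z x)) (deriv G (z x) • fderiv ℝ z x) x :=
      ((hG.differentiable (by norm_num)) (z x)).hasDerivAt.comp_hasFDerivAt x
        ((hzC.differentiable (by norm_num)) x).hasFDerivAt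
    have h4 : HasFDerivAt (fun x => η x ^ 2) ((2 * η x) • fderiv ℝ η x) x := by
      have := ((hη.differentiable (by norm_num)) x).hasFDerivAt.pow 2
      simpa using this
    have h5 : HasFDerivAt ζ _ x := h4.mul (h3.mul h2)
    rw [h5.fderiv, hDw]
    have hne := (hwp x).ne'
    ext v
    simp only [ContinuousLinearMap.add_apply, ContinuousLinearMap.smul_apply, smul_eq_mul,
      ContinuousLinearMap.neg_apply]
    field_simp
    ring
  have hDzc : Continuous (fun x => fderiv ℝ z x) := hzC.continuous_fderiv (by norm_num)
  have hDηc : Continuous (fun x => fderiv ℝ η x) := hη.continuous_fderiv (by norm_num)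
  have hDwc : Continuous (fun x => fderiv ℝ w x) := hw.continuous_fderiv (by norm_num)
  have hDζc : Continuous (fun x => fderiv ℝ ζ x) := hζC.continuous_fderiv (by norm_num)
  have hbc := hb.cont
  have hzc := hzC.continuous
  have hGc := hG.continuous
  have hηcont := hη.continuous
  have i1 : Integrable (fun x => η x ^ 2 * G (z x) * ‖fderiv ℝ z x‖ ^ 2) :=
    Continuous.integrable_of_hasCompactSupport (by fun_prop) hη2.mul_right.mul_right
  have i2 : Integrable (fun x => G (z x) * ‖fderiv ℝ η x‖ ^ 2) :=
    Continuous.integrable_of_hasCompactSupport (by fun_prop)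
      (((hηc.fderiv (𝕜 := ℝ)).comp_left (g := fun t => ‖t‖ ^ 2) (by simp)).mul_left)
  have i3 : Integrable (fun x => η x ^ 2 * G (z x)) :=
    Continuous.integrable_of_hasCompactSupport (by fun_prop) hη2.mul_right
  have i4 : Integrable ζ := hζC.continuous.integrable_of_hasCompactSupport hζc
  have i5 : Integrable (fun x => b x (fderiv ℝ w x) (fderiv ℝ ζ x)) := by
    apply Continuous.integrable_of_hasCompactSupport (by fun_prop)
    refine (hζc.fderiv (𝕜 := ℝ)).mono' ?_
    intro x hx
    apply subset_tsupport
    intro h0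
    apply hx
    simp only [h0, map_zero]
  have e1 : δ * ∫ x, ζ x ≤ ∫ x, η x ^ 2 * G (z x) := by
    rw [← integral_const_mul]
    refine integral_mono (i4.const_mul δ) i3 fun x => ?_
    simp only [hζ]
    have h1 : δ * (w x + δ)⁻¹ ≤ 1 := by
      rw [← div_eq_mul_inv, div_le_one (hwp x)]; linarith [hw0 x]
    have h2 : 0 ≤ η x ^ 2 * G (z x) := mul_nonneg (sq_nonneg _) (hG0 _)
    nlinarith
  have e2 : ∫ x, b x (fderiv ℝ w x) (fderiv ℝ ζ x) ≤
      -(2 * Λ)⁻¹ * (∫ x, η x ^ 2 * G (z x) * ‖fderiv ℝ z x‖ ^ 2) +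
        2 * Λ * ∫ x, G (z x) * ‖fderiv ℝ η x‖ ^ 2 := by
    rw [← integral_const_mul, ← integral_const_mul, ← integral_add (i1.const_mul _) (i2.const_mul _)]
    refine integral_mono i5 ((i1.const_mul _).add (i2.const_mul _)) fun x => ?_
    simp only
    rw [hDζ, hDw]
    simp only [map_add, map_smul, map_neg, ContinuousLinearMap.neg_apply,
      ContinuousLinearMap.smul_apply, smul_eq_mul]
    have hne := (hwp x).ne'
    have y := hb.young hΛ x (fderiv ℝ z x) (fderiv ℝ η x) (η x)
    have l := hb.lower x (fderiv ℝ z x)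
    have u := hb.upper x (fderiv ℝ η x)
    have g0 := hG0 (z x)
    have g1 := hG1 (z x)
    set P := b x (fderiv ℝ z x) (fderiv ℝ z x)
    set Q := b x (fderiv ℝ z x) (fderiv ℝ η x)
    set S := b x (fderiv ℝ η x) (fderiv ℝ η x)
    have hP : 0 ≤ P := le_trans (by positivity) l
    calc _ = -(2 * η x * Q) * G (z x) - η x ^ 2 * deriv G (z x) * P - η x ^ 2 * G (z x) * P := by
            field_simp; ring
      _ ≤ ((1/2) * η x ^ 2 * P + 2 * S) * G (z x) - η x ^ 2 * G (z x) * P := by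
            have := mul_le_mul_of_nonneg_right y g0
            have : 0 ≤ η x ^ 2 * deriv G (z x) * P := by positivity
            linarith
      _ = -(1/2) * (η x ^ 2 * G (z x)) * P + 2 * G (z x) * S := by ring
      _ ≤ -(1/2) * (η x ^ 2 * G (z x)) * (Λ⁻¹ * ‖fderiv ℝ z x‖ ^ 2) +
            2 * G (z x) * (Λ * ‖fderiv ℝ η x‖ ^ 2) := by
            have h1 : 0 ≤ η x ^ 2 * G (z x) := by positivity
            have h2 := mul_le_mul_of_nonneg_left l h1
            have h3 := mul_le_mul_of_nonneg_left u g0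
            linarith
      _ = _ := by rw [mul_inv]; ring
  have e3 : (2 * Λ)⁻¹ * (∫ x, η x ^ 2 * G (z x) * ‖fderiv ℝ z x‖ ^ 2) ≤
      2 * Λ * (∫ x, G (z x) * ‖fderiv ℝ η x‖ ^ 2) + ∫ x, η x ^ 2 * G (z x) := by linarith
  have e4 := mul_le_mul_of_nonneg_left e3 (show 0 ≤ 2 * Λ by positivity)
  rw [← mul_assoc, mul_inv_cancel₀ (by positivity), one_mul] at e4
  linarith

theorem lintegral_aff {n : ℕ} {g : EE n → ENNReal} (hg : Measurable g) {r : ℝ} {x : EE n}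
    (hx : x ∈ ball (0 : EE n) r) {t : ℝ} (ht : t ∈ Icc (1/2 : ℝ) 1) :
    ∫⁻ y in ball (0 : EE n) r, g (x + t • (y - x)) ≤ 2 ^ n * ∫⁻ y in ball (0 : EE n) r, g y := by
  have ht0 : 0 < t := by linarith [ht.1]
  have hB : MeasurableSet (ball (0 : EE n) r) := measurableSet_ball
  rw [← lintegral_indicator hB, ← lintegral_indicator hB]
  calc ∫⁻ y, (ball (0 : EE n) r).indicator (fun y => g (x + t • (y - x))) y
      ≤ ∫⁻ y, ((ball (0 : EE n) r).indicator g) ((x - t • x) + t • y) := by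
        refine lintegral_mono fun y => ?_
        by_cases hy : y ∈ ball (0 : EE n) r
        · have h1 : (x - t • x) + t • y = x + t • (y - x) := by rw [smul_sub]; abel
          have h2 : x + t • (y - x) ∈ ball (0 : EE n) r :=
            (convex_ball (0 : EE n) r).add_smul_sub_mem hx hy ⟨ht0.le, ht.2⟩
          simp only [indicator_of_mem hy]
          rw [h1, indicator_of_mem h2]
        · simp only [indicator_of_notMem hy]; exact zero_le
    _ = ∫⁻ y, ((ball (0 : EE n) r).indicator g) ((x - t • x) + y)
          ∂(Measure.map (fun y => t • y) (volume : Measure (EE n))) := by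
        rw [lintegral_map]
        · exact (hg.indicator hB).comp (measurable_const_add _)
        · exact measurable_const_smul t
    _ = ENNReal.ofReal |(t ^ Module.finrank ℝ (EE n))⁻¹| *
          ∫⁻ y, ((ball (0 : EE n) r).indicator g) y := by
        rw [Measure.map_addHaar_smul _ ht0.ne', lintegral_smul_measure, lintegral_add_left_eq_self]
        rfl
    _ ≤ _ := by
        gcongr
        rw [finrank_euclideanSpace_fin, abs_of_nonneg (by positivity), ← inv_pow,
          ENNReal.ofReal_pow (by positivity)]
        gcongr
        rw [show (2 : ENNReal) = ENNReal.ofReal 2 by simp]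
        apply ENNReal.ofReal_le_ofReal
        rw [inv_le_comm₀ ht0 (by norm_num)]
        linarith [ht.1]

theorem ftc_line {n : ℕ} {v : EE n → ℝ} (hv : ContDiff ℝ 1 v) {r : ℝ} {x y : EE n}
    (hx : x ∈ ball (0 : EE n) r) (hy : y ∈ ball (0 : EE n) r) (hvy : v y = 0) :
    ‖v x‖ₑ ≤ ENNReal.ofReal (2 * r) *
      ∫⁻ t in Icc (0:ℝ) 1, ‖fderiv ℝ v (x + t • (y - x))‖ₑ := by
  have hγ : ContDiff ℝ 1 (fun t : ℝ => v (x + t • (y - x))) :=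
    hv.comp (contDiff_const.add (contDiff_id.smul contDiff_const))
  have h := enorm_sub_le_lintegral_derivWithin_Icc_of_contDiffOn_Icc hγ.contDiffOn zero_le_one
  simp only [one_smul, add_sub_cancel, hvy, zero_smul, add_zero, zero_sub, enorm_neg] at h
  refine h.trans ?_
  rw [← lintegral_const_mul' _ _ ENNReal.ofReal_ne_top]
  refine setLIntegral_mono' measurableSet_Icc fun t ht => ?_
  have hd : HasDerivAt (fun t : ℝ => v (x + t • (y - x))) (fderiv ℝ v (x + t • (y - x)) (y - x)) t := by
    have h1 : HasDerivAt (fun t : ℝ => x + t • (y - x)) (y - x) t := by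
      simpa using ((hasDerivAt_id t).smul_const (y - x)).const_add x
    exact ((hv.differentiable (by norm_num)) _).hasFDerivAt.comp_hasDerivAt t h1
  rw [hd.hasDerivWithinAt.derivWithin (uniqueDiffOn_Icc_zero_one t ht)]
  refine (ContinuousLinearMap.le_opENorm _ _).trans ?_
  rw [mul_comm]
  gcongr
  rw [← ofReal_norm]
  apply ENNReal.ofReal_le_ofReal
  rw [mem_ball_zero_iff] at hx hy
  linarith [norm_sub_le y x]

theorem poincare {n : ℕ} {v : EE n → ℝ} (hv : ContDiff ℝ 1 v) {r : ℝ} 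
    {N : Set (EE n)} (hN : N ⊆ ball 0 r) (hNm : MeasurableSet N) (hvN : ∀ y ∈ N, v y = 0) :
    volume N * ∫⁻ x in ball (0 : EE n) r, ‖v x‖ₑ ≤
      ENNReal.ofReal (2 * r) * (2 ^ n * (volume (ball (0 : EE n) r) *
        ∫⁻ x in ball (0 : EE n) r, ‖fderiv ℝ v x‖ₑ)) := by
  set B := ball (0 : EE n) r with hB
  have hBm : MeasurableSet B := measurableSet_ball
  have hDc : Continuous (fun x => fderiv ℝ v x) := hv.continuous_fderiv (by norm_num)
  have hgm : Measurable (fun x => ‖fderiv ℝ v x‖ₑ) := hDc.enorm.measurable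
  set g : EE n → ENNReal := fun x => ‖fderiv ℝ v x‖ₑ with hg
  have hgc : Continuous g := hDc.enorm
  have step1 : volume N * ∫⁻ x in B, ‖v x‖ₑ ≤
      ENNReal.ofReal (2 * r) * ∫⁻ x in B, ∫⁻ y in B, ∫⁻ t in Icc (0:ℝ) 1, g (x + t • (y - x)) := by
    rw [← lintegral_const_mul' _ _ ENNReal.ofReal_ne_top, ← lintegral_const_mul _ (by
      exact hv.continuous.enorm.measurable)]
    refine setLIntegral_mono' hBm fun x hx => ?_
    calc volume N * ‖v x‖ₑ = ∫⁻ y in N, ‖v x‖ₑ := by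
          rw [setLIntegral_const, mul_comm]
      _ ≤ ∫⁻ y in N, ENNReal.ofReal (2 * r) * ∫⁻ t in Icc (0:ℝ) 1, g (x + t • (y - x)) :=
          setLIntegral_mono' hNm fun y hy => ftc_line hv hx (hN hy) (hvN y hy)
      _ ≤ ∫⁻ y in B, ENNReal.ofReal (2 * r) * ∫⁻ t in Icc (0:ℝ) 1, g (x + t • (y - x)) :=
          lintegral_mono_set hN
      _ = _ := lintegral_const_mul' _ _ ENNReal.ofReal_ne_top
  refine step1.trans ?_
  gcongr
  have sw1 : ∀ x, ∫⁻ y in B, ∫⁻ t in Icc (0:ℝ) 1, g (x + t • (y - x)) =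
      ∫⁻ t in Icc (0:ℝ) 1, ∫⁻ y in B, g (x + t • (y - x)) := by
    intro x
    rw [lintegral_lintegral_swap]
    apply Measurable.aemeasurable
    apply Continuous.measurable
    simp only [Function.uncurry_def]
    exact hgc.comp (by fun_prop)
  simp_rw [sw1]
  have m3 : Measurable (fun q : (EE n × ℝ) × EE n => g (q.1.1 + q.1.2 • (q.2 - q.1.1))) :=
    (hgc.comp (by fun_prop)).measurable
  rw [lintegral_lintegral_swap (by
    apply Measurable.aemeasurable
    exact m3.lintegral_prod_right' (ν := volume.restrict B))]
  have hJ : ∀ t ∈ Icc (0:ℝ) 1, ∫⁻ x in B, ∫⁻ y in B, g (x + t • (y - x)) ≤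
      2 ^ n * (volume B * ∫⁻ x in B, g x) := by
    intro t ht
    have fin : ∀ k : EE n → ENNReal, (∀ x ∈ B, k x ≤ 2 ^ n * ∫⁻ x in B, g x) →
        ∫⁻ x in B, k x ≤ 2 ^ n * (volume B * ∫⁻ x in B, g x) := by
      intro k hk
      calc ∫⁻ x in B, k x ≤ ∫⁻ x in B, (2 ^ n * ∫⁻ x in B, g x) := setLIntegral_mono' hBm hk
        _ = _ := by rw [setLIntegral_const]; ring
    rcases le_total (1/2) t with h | h
    · exact fin _ fun x hx => lintegral_aff hgm hx ⟨h, ht.2⟩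
    · rw [lintegral_lintegral_swap]
      · refine fin _ fun y hy => ?_
        have := lintegral_aff hgm hy (t := 1 - t) ⟨by linarith, by linarith [ht.1]⟩
        refine le_trans (le_of_eq ?_) this
        refine lintegral_congr fun x => ?_
        congr 1
        module
      · apply Measurable.aemeasurable
        apply Continuous.measurable
        simp only [Function.uncurry_def]
        exact hgc.comp (by fun_prop)
  calc _ ≤ ∫⁻ t in Icc (0:ℝ) 1, 2 ^ n * (volume B * ∫⁻ x in B, g x) :=
        setLIntegral_mono' measurableSet_Icc hJ
    _ = _ := by rw [setLIntegral_const]; simp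

theorem integrableOn_ball_of_continuous {n : ℕ} {g : EE n → ℝ} (hg : Continuous g) (r : ℝ) :
    IntegrableOn g (ball (0 : EE n) r) :=
  (hg.continuousOn.integrableOn_compact (isCompact_closedBall (0 : EE n) r)).mono_set
    ball_subset_closedBall

theorem poincare_real {n : ℕ} {v : EE n → ℝ} (hv : ContDiff ℝ 1 v) (hv0 : ∀ x, 0 ≤ v x)
    {r : ℝ} (hr : 0 < r) (hr1 : r ≤ 1)
    {N : Set (EE n)} (hN : N ⊆ ball 0 r) (hNm : MeasurableSet N) (hvN : ∀ y ∈ N, v y = 0)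
    (hvol : volume (ball (0 : EE n) r) ≤ 2 * volume N) :
    ∫ x in ball (0 : EE n) r, v x ≤ 2 ^ (n + 2) * ∫ x in ball (0 : EE n) r, ‖fderiv ℝ v x‖ := by
  have hp := poincare hv hN hNm hvN
  have hDc : Continuous (fun x => fderiv ℝ v x) := hv.continuous_fderiv (by norm_num)
  have iv := integrableOn_ball_of_continuous hv.continuous r
  have iD := integrableOn_ball_of_continuous hDc.norm r
  set B := ball (0 : EE n) r with hB
  have hB0 : volume B ≠ 0 := (measure_ball_pos volume (0 : EE n) hr).ne'
  have hB1 : volume B ≠ ⊤ := measure_ball_lt_top.ne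
  set I := ∫⁻ x in B, ‖v x‖ₑ with hI
  set J := ∫⁻ x in B, ‖fderiv ℝ v x‖ₑ with hJ
  have h1 : volume B * I ≤ volume B * (2 ^ (n + 2) * J) := by
    calc volume B * I ≤ 2 * volume N * I := by gcongr
      _ = 2 * (volume N * I) := by ring
      _ ≤ 2 * (ENNReal.ofReal (2 * r) * (2 ^ n * (volume B * J))) := by gcongr
      _ ≤ 2 * (2 * (2 ^ n * (volume B * J))) := by
          gcongr
          rw [show (2 : ENNReal) = ENNReal.ofReal 2 by simp]
          apply ENNReal.ofReal_le_ofReal; linarith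
      _ = _ := by ring
  have h2 : I ≤ 2 ^ (n + 2) * J := (ENNReal.mul_le_mul_iff_right hB0 hB1).mp h1
  have eI : ENNReal.ofReal (∫ x in B, v x) = I := by
    rw [hI, ← ofReal_integral_norm_eq_lintegral_enorm iv]
    congr 1
    exact integral_congr_ae (Filter.Eventually.of_forall fun x => (Real.norm_of_nonneg (hv0 x)).symm)
  have eJ : ENNReal.ofReal (∫ x in B, ‖fderiv ℝ v x‖) = J := by
    rw [hJ, ofReal_integral_norm_eq_lintegral_enorm]
    exact integrable_norm_iff (hDc.aestronglyMeasurable) |>.mp iD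
  rw [← eI, ← eJ, show (2 : ENNReal) ^ (n + 2) = ENNReal.ofReal (2 ^ (n + 2)) by
    rw [ENNReal.ofReal_pow (by norm_num)]; simp, ← ENNReal.ofReal_mul (by positivity)] at h2
  refine (ENNReal.ofReal_le_ofReal_iff ?_).mp h2
  exact mul_nonneg (by positivity) (integral_nonneg fun x => norm_nonneg _)

theorem hasFDerivAt_sqp_comp {n : ℕ} {z : EE n → ℝ} (hz : ContDiff ℝ 1 z) (k : ℝ) (x : EE n) :
    HasFDerivAt (fun x => sqp (z x - k)) ((2 * max (z x - k) 0) • fderiv ℝ z x) x :=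
  (hasDerivAt_sqp _).comp_hasFDerivAt x
    (((hz.differentiable (by norm_num)) x).hasFDerivAt.sub_const k)

noncomputable def initC (n : ℕ) (Λ : ℝ) : ℝ :=
  4 * (2 ^ (n + 2)) ^ 2 *
    (4 * Λ ^ 2 * (∫ x : EE n, 1 * ‖fderiv ℝ (cut 16 (13/16) : EE n → ℝ) x‖ ^ 2) +
      2 * Λ * ∫ x : EE n, cut 16 (13/16) x ^ 2 * 1)

theorem init_bound {n : ℕ} {Λ : ℝ} (hΛ : 1 ≤ Λ) {b : EE n → DD n →L[ℝ] DD n →L[ℝ] ℝ}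
    (hb : Ell n Λ b) {w : EE n → ℝ} (hw : ContDiff ℝ 1 w) (hw0 : ∀ x, 0 ≤ w x)
    {δ : ℝ} (hδ : 0 < δ) (hs : SuperSol n b w δ) {h : ℝ} (hh : 0 ≤ h)
    (hvol : volume (ball (0 : EE n) (3/4)) ≤ 2 * volume {x ∈ ball (0 : EE n) (3/4) | h ≤ w x})
    {z : EE n → ℝ} (hz : z = fun x => Real.log (h + δ) - Real.log (w x + δ)) :
    ∫ x in ball (0 : EE n) (3/4), sqp (z x - 0) ≤ initC n Λ := by
  have hwp : ∀ x, 0 < w x + δ := fun x => by linarith [hw0 x]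
  have hwd : ContDiff ℝ 1 (fun x => w x + δ) := hw.add contDiff_const
  have hzC : ContDiff ℝ 1 z := by
    rw [hz]; exact contDiff_const.sub (hwd.log fun x => (hwp x).ne')
  have hDzc : Continuous (fun x => fderiv ℝ z x) := hzC.continuous_fderiv (by norm_num)
  have hvC : ContDiff ℝ 1 (fun x => sqp (z x - 0)) := contDiff_sqp.comp (hzC.sub contDiff_const)
  have hDv : ∀ x, fderiv ℝ (fun x => sqp (z x - 0)) x = _ :=
    fun x => (hasFDerivAt_sqp_comp hzC 0 x).fderiv
  have P := poincare_real hvC (fun x => sqp_nonneg _) (r := 3/4) (by norm_num) (by norm_num)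
    (N := {x ∈ ball (0 : EE n) (3/4) | h ≤ w x}) (fun x hx => hx.1)
    (measurableSet_ball.inter (measurableSet_le measurable_const hw.continuous.measurable))
    (fun y hy => by
      apply sqp_of_nonpos
      rw [hz]
      have : Real.log (h + δ) ≤ Real.log (w y + δ) :=
        Real.log_le_log (by linarith) (by linarith [hy.2])
      simp only
      linarith) hvol
  have hL : (0:ℝ) ≤ 16 := by norm_num
  have hr : (0:ℝ) ≤ 13/16 := by norm_num
  have hηc := hasCompactSupport_cut (n := n) hL hr
  have cac := caccioppoli hΛ hb hw hw0 hδ hs hz (contDiff_cut (n := n) 16 (13/16))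
    hηc ((tsupport_cut hL hr).trans (closedBall_subset_ball (by norm_num)))
    (G := fun _ => 1) contDiff_const (by simp) (by simp)
  set B := ball (0 : EE n) (3/4) with hB
  set p : ℝ := 2 ^ (n + 2) with hp
  have hp0 : 0 < p := by positivity
  set I := ∫ x in B, sqp (z x - 0) with hI
  set J := ∫ x in B, ‖fderiv ℝ z x‖ ^ 2 with hJ
  have iI : IntegrableOn (fun x => sqp (z x - 0)) B :=
    integrableOn_ball_of_continuous hvC.continuous _
  have iJ : IntegrableOn (fun x => ‖fderiv ℝ z x‖ ^ 2) B :=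
    integrableOn_ball_of_continuous (hDzc.norm.pow 2) _
  have h1 : ∫ x in B, ‖fderiv ℝ (fun x => sqp (z x - 0)) x‖ ≤ (2 * p)⁻¹ * I + 2 * p * J := by
    rw [hI, hJ, ← integral_const_mul, ← integral_const_mul,
      ← integral_add (iI.const_mul _) (iJ.const_mul _)]
    refine integral_mono
      (integrableOn_ball_of_continuous (hvC.continuous_fderiv (by norm_num)).norm _)
      ((iI.const_mul _).add (iJ.const_mul _)) fun x => ?_
    simp only [hDv, norm_smul, Real.norm_eq_abs]
    rw [abs_of_nonneg (by positivity), sqp]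
    set m := max (z x - 0) 0
    set D := ‖fderiv ℝ z x‖
    have : 0 ≤ (2 * p)⁻¹ * (m - 2 * p * D) ^ 2 := by positivity
    have e : (2 * p)⁻¹ * (m - 2 * p * D) ^ 2 = (2 * p)⁻¹ * m ^ 2 - 2 * m * D + 2 * p * D ^ 2 := by
      field_simp
      ring
    linarith
  have h2 : I ≤ 4 * p ^ 2 * J := by
    have h3 := P.trans (mul_le_mul_of_nonneg_left h1 hp0.le)
    have : p * ((2 * p)⁻¹ * I + 2 * p * J) = I / 2 + 2 * p ^ 2 * J := by field_simp
    rw [this] at h3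
    linarith
  have h4 : J ≤ ∫ x, cut 16 (13/16) x ^ 2 * 1 * ‖fderiv ℝ z x‖ ^ 2 := by
    have ii : Integrable (fun x : EE n => cut 16 (13/16) x ^ 2 * 1 * ‖fderiv ℝ z x‖ ^ 2) := by
      apply Continuous.integrable_of_hasCompactSupport
      · have := (contDiff_cut (n := n) 16 (13/16)).continuous
        fun_prop
      · exact ((hηc.comp_left (g := fun t : ℝ => t ^ 2) (by norm_num)).mul_right).mul_right
    refine le_trans ?_ (setIntegral_le_integral (s := B) ii
      (Filter.Eventually.of_forall fun x => by simp only [Pi.zero_apply]; positivity))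
    refine setIntegral_mono_on iJ ii.integrableOn measurableSet_ball fun x hx => ?_
    have hx' : ‖x‖ ≤ 3/4 := by
      rw [hB, mem_ball_zero_iff] at hx; exact hx.le
    have := one_le_cut (n := n) (L := 16) (r := 13/16) (r' := 3/4) hL (by norm_num) hx'
    have h5 : 1 ≤ cut 16 (13/16) x ^ 2 * 1 := by nlinarith
    nlinarith [sq_nonneg ‖fderiv ℝ z x‖]
  calc I ≤ 4 * p ^ 2 * J := h2
    _ ≤ _ := by
      unfold initC
      exact mul_le_mul_of_nonneg_left (h4.trans cac) (by positivity)

/-- The Sobolev constant. -/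
noncomputable def sobC (n : ℕ) : ℝ :=
  (eLpNormLESNormFDerivOneConst (volume : Measure (EE n)) (((n : NNReal) / ((n : NNReal) - 1)) : NNReal) : ℝ)

theorem sobC_nonneg (n : ℕ) : 0 ≤ sobC n := NNReal.coe_nonneg _

theorem sobolev_hoelder {n : ℕ} (hn : 2 ≤ n) {v : EE n → ℝ} (hv : ContDiff ℝ 1 v)
    (hvc : HasCompactSupport v) (hv0 : ∀ x, 0 ≤ v x) {S : Set (EE n)}
    (hvS : ∀ x, x ∉ S → v x = 0) (hSf : volume S ≠ ⊤) :
    ∫ x, v x ≤ sobC n * (∫ x, ‖fderiv ℝ v x‖) * (volume.real S) ^ (1 / (n : ℝ)) := by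
  have hn0 : (0:ℝ) < n := by positivity
  have hn1 : (1:ℝ) < n := by exact_mod_cast hn
  set p : NNReal := (n : NNReal) / ((n : NNReal) - 1) with hp
  have hn1' : (1 : NNReal) < n := by exact_mod_cast hn
  have hconj : NNReal.HolderConjugate (Module.finrank ℝ (EE n) : ℕ) p := by
    rw [finrank_euclideanSpace_fin]
    exact NNReal.HolderConjugate.conjExponent hn1'
  have hpR := hconj.coe
  have hp1 : (1 : NNReal) ≤ p := hconj.symm.lt.le
  have gns := eLpNorm_le_eLpNorm_fderiv_one (volume : Measure (EE n)) hv hvc hconj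
  have iv : Integrable v := hv.continuous.integrable_of_hasCompactSupport hvc
  have hDc : Continuous (fun x => fderiv ℝ v x) := hv.continuous_fderiv (by norm_num)
  have iD : Integrable (fun x => fderiv ℝ v x) :=
    hDc.integrable_of_hasCompactSupport (hvc.fderiv (𝕜 := ℝ))
  have hol := eLpNorm_le_eLpNorm_mul_rpow_measure_univ (μ := volume.restrict S) (f := v)
    (p := 1) (q := p) (by exact_mod_cast hp1) hv.continuous.aestronglyMeasurable
  have hexp : 1 / (1 : ENNReal).toReal - 1 / (p : ENNReal).toReal = 1 / (n : ℝ) := by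
    have := hpR.inv_add_inv_eq_one
    rw [finrank_euclideanSpace_fin] at this
    simp only [ENNReal.toReal_one, ENNReal.coe_toReal]
    simp only [NNReal.coe_natCast] at this
    rw [one_div, one_div, one_div, inv_one]; linarith
  rw [hexp, Measure.restrict_apply_univ, eLpNorm_one_eq_lintegral_enorm] at hol
  have e1 : ∫⁻ x in S, ‖v x‖ₑ = ENNReal.ofReal (∫ x, v x) := by
    rw [← ofReal_integral_norm_eq_lintegral_enorm iv.integrableOn]
    congr 1
    rw [← setIntegral_eq_integral_of_forall_compl_eq_zero hvS]
    exact integral_congr_ae (Filter.Eventually.of_forall fun x => (Real.norm_of_nonneg (hv0 x)))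
  have e2 : eLpNorm (fderiv ℝ v) 1 volume = ENNReal.ofReal (∫ x, ‖fderiv ℝ v x‖) := by
    rw [eLpNorm_one_eq_lintegral_enorm, ofReal_integral_norm_eq_lintegral_enorm iD]
  rw [e1] at hol
  rw [e2] at gns
  have h3 : ENNReal.ofReal (∫ x, v x) ≤
      (ENNReal.ofReal (sobC n) * ENNReal.ofReal (∫ x, ‖fderiv ℝ v x‖)) *
        ENNReal.ofReal (volume.real S ^ (1 / (n:ℝ))) := by
    refine hol.trans ?_
    gcongr
    · refine (eLpNorm_mono_measure _ Measure.restrict_le_self).trans (gns.trans ?_)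
      gcongr
      rw [sobC, ENNReal.ofReal_coe_nnreal]
    · rw [← ENNReal.ofReal_rpow_of_nonneg measureReal_nonneg (by positivity), ofReal_measureReal hSf]
  have hI : 0 ≤ ∫ x, ‖fderiv ℝ v x‖ := integral_nonneg fun x => norm_nonneg _
  rw [← ENNReal.ofReal_mul (sobC_nonneg n), ← ENNReal.ofReal_mul (mul_nonneg (sobC_nonneg n) hI)] at h3
  refine (ENNReal.ofReal_le_ofReal_iff ?_).mp h3
  exact mul_nonneg (mul_nonneg (sobC_nonneg n) hI) (by positivity)

set_option maxHeartbeats 1000000 in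
theorem degiorgi_step {n : ℕ} (hn : 2 ≤ n) {Λ : ℝ} (hΛ : 1 ≤ Λ)
    {b : EE n → DD n →L[ℝ] DD n →L[ℝ] ℝ}
    (hb : Ell n Λ b) {w : EE n → ℝ} (hw : ContDiff ℝ 1 w) (hw0 : ∀ x, 0 ≤ w x)
    {δ : ℝ} (hδ : 0 < δ) (hs : SuperSol n b w δ) {H : ℝ}
    {z : EE n → ℝ} (hz : z = fun x => H - Real.log (w x + δ))
    {r r' k k' L : ℝ} (hr' : 0 ≤ r') (hrr : r' ≤ r) (hr : r ≤ 3/4) (hL : 1 ≤ L)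
    (hLr : 1 ≤ L * (r ^ 2 - r' ^ 2)) (hk : k < k') :
    ∫ x in ball (0 : EE n) r', sqp (z x - k') ≤
      sobC n * (84 * Λ ^ 2 * L ^ 4 * (1 + ((k' - k) ^ 2)⁻¹) * ∫ x in ball (0 : EE n) r, sqp (z x - k))
        * (((k' - k) ^ 2)⁻¹ * ∫ x in ball (0 : EE n) r, sqp (z x - k)) ^ (1 / (n : ℝ)) := by
  have hL0 : 0 ≤ L := by linarith
  have hr0 : 0 ≤ r := hr'.trans hrr
  have hr1 : r ≤ 1 := by linarith
  have hd : 0 < k' - k := by linarith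
  have hwp : ∀ x, 0 < w x + δ := fun x => by linarith [hw0 x]
  have hwd : ContDiff ℝ 1 (fun x => w x + δ) := hw.add contDiff_const
  have hzC : ContDiff ℝ 1 z := by
    rw [hz]; exact contDiff_const.sub (hwd.log fun x => (hwp x).ne')
  have hDzc : Continuous (fun x => fderiv ℝ z x) := hzC.continuous_fderiv (by norm_num)
  have hGC : ∀ k, ContDiff ℝ 1 (fun x => sqp (z x - k)) :=
    fun k => contDiff_sqp.comp (hzC.sub contDiff_const)
  set B := ball (0 : EE n) r with hB
  set Y := ∫ x in B, sqp (z x - k) with hY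
  set c := ((k' - k) ^ 2)⁻¹ with hc
  have hc0 : 0 ≤ c := by positivity
  have hmono : ∀ x, sqp (z x - k') ≤ sqp (z x - k) := fun x => by
    unfold sqp
    have : max (z x - k') 0 ≤ max (z x - k) 0 := max_le_max (by linarith) le_rfl
    exact pow_le_pow_left₀ (le_max_right _ _) this 2
  have hgap : ∀ x, k' < z x → 1 ≤ c * sqp (z x - k) := fun x hx => by
    rw [sqp_of_nonneg (by linarith), hc, inv_mul_eq_div, one_le_div (by positivity)]
    exact pow_le_pow_left₀ hd.le (by linarith) 2
  have iY : IntegrableOn (fun x => sqp (z x - k)) B :=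
    integrableOn_ball_of_continuous (hGC k).continuous _
  have hY0 : 0 ≤ Y := integral_nonneg fun x => sqp_nonneg _
  -- comparison principle
  have comp : ∀ (q : EE n → ℝ) (C : ℝ), Integrable q → (∀ x, r ≤ ‖x‖ → q x = 0) →
      (∀ x, q x ≤ C * sqp (z x - k)) → ∫ x, q x ≤ C * Y := by
    intro q C iq hq0 hq
    rw [← setIntegral_eq_integral_of_forall_compl_eq_zero (s := B), hY, ← integral_const_mul]
    · exact setIntegral_mono_on iq.integrableOn (iY.const_mul C) measurableSet_ball fun x _ => hq x
    · intro x hx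
      apply hq0
      rw [hB, mem_ball_zero_iff, not_lt] at hx
      exact hx
  set η : EE n → ℝ := cut L r with hη
  have hηC : ContDiff ℝ 1 η := contDiff_cut L r
  have hηcont := hηC.continuous
  have hηc : HasCompactSupport η := hasCompactSupport_cut hL0 hr0
  have hηs : tsupport η ⊆ ball 0 (7/8) :=
    (tsupport_cut hL0 hr0).trans (closedBall_subset_ball (by linarith))
  have hη0 : ∀ x, r ≤ ‖x‖ → η x = 0 := fun x hx => cut_eq_zero hL0 hr0 hx
  have hDη0 : ∀ x, r ≤ ‖x‖ → fderiv ℝ η x = 0 := fun x hx => fderiv_cut_eq_zero hL0 hr0 hx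
  have hηn : ∀ x, 0 ≤ η x := cut_nonneg L r
  have hηle : ∀ x, η x ^ 2 ≤ L ^ 4 := fun x => by
    calc η x ^ 2 ≤ (L ^ 2) ^ 2 := pow_le_pow_left₀ (hηn x) (cut_le hL0 hr0 hr1 x) 2
      _ = L ^ 4 := by ring
  have hDηle : ∀ x, ‖fderiv ℝ η x‖ ^ 2 ≤ 16 * L ^ 4 := fun x => by
    calc ‖fderiv ℝ η x‖ ^ 2 ≤ (4 * L ^ 2) ^ 2 :=
          pow_le_pow_left₀ (norm_nonneg _) (norm_fderiv_cut_le hL0 hr0 hr1 x) 2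
      _ = 16 * L ^ 4 := by ring
  have hDηc : Continuous (fun x => fderiv ℝ η x) := hηC.continuous_fderiv (by norm_num)
  have hη2 : HasCompactSupport (fun x => η x ^ 2) :=
    hηc.comp_left (g := fun t : ℝ => t ^ 2) (by norm_num)
  have hDη2 : HasCompactSupport (fun x => ‖fderiv ℝ η x‖ ^ 2) :=
    (hηc.fderiv (𝕜 := ℝ)).comp_left (g := fun t => ‖t‖ ^ 2) (by simp)
  have cac := caccioppoli hΛ hb hw hw0 hδ hs hz hηC hηc hηs (G := fun t => sqp (t - k'))
    (contDiff_sqp.comp (contDiff_id.sub contDiff_const)) (fun t => sqp_nonneg _) (fun t => by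
      have : HasDerivAt (fun t => sqp (t - k')) (2 * max (t - k') 0) t := by
        exact (hasDerivAt_sqp (t - k')).comp_sub_const t k'
      rw [this.deriv]; positivity)
  set v : EE n → ℝ := fun x => η x ^ 2 * sqp (z x - k') with hv
  have hvC : ContDiff ℝ 1 v := (hηC.pow 2).mul (hGC k')
  have hvc : HasCompactSupport v := hη2.mul_right
  have hv0 : ∀ x, 0 ≤ v x := fun x => mul_nonneg (sq_nonneg _) (sqp_nonneg _)
  have hGk := (hGC k).continuous
  have hGk' := (hGC k').continuous
  have ivv : Integrable v := hvC.continuous.integrable_of_hasCompactSupport hvc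
  -- left side
  have hleft : ∫ x in ball (0 : EE n) r', sqp (z x - k') ≤ ∫ x, v x := by
    refine le_trans ?_ (setIntegral_le_integral (s := ball (0 : EE n) r') ivv
      (Filter.Eventually.of_forall hv0))
    refine setIntegral_mono_on (integrableOn_ball_of_continuous hGk' _) ivv.integrableOn
      measurableSet_ball fun x hx => ?_
    have hx' : ‖x‖ ≤ r' := by
      rw [mem_ball_zero_iff] at hx; exact hx.le
    have h1 : 1 ≤ η x := one_le_cut hL0 hLr hx'
    have h2 : 1 ≤ η x ^ 2 := by nlinarith
    have := sqp_nonneg (z x - k')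
    simp only [hv]
    nlinarith
  set S : Set (EE n) := {x ∈ B | k' < z x} with hSdef
  have hSm : MeasurableSet S :=
    measurableSet_ball.inter (measurableSet_lt measurable_const hzC.continuous.measurable)
  have hSB : S ⊆ B := fun x hx => hx.1
  have hSf : volume S ≠ ⊤ := ((measure_mono hSB).trans_lt measure_ball_lt_top).ne
  have hvS : ∀ x, x ∉ S → v x = 0 := by
    intro x hx
    by_cases hxB : x ∈ B
    · have : z x ≤ k' := by
        by_contra hcon
        exact hx ⟨hxB, not_le.mp hcon⟩
      simp only [hv]
      rw [sqp_of_nonpos (by linarith), mul_zero]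
    · rw [hB, mem_ball_zero_iff, not_lt] at hxB
      simp [hv, hη0 x hxB]
  have sob := sobolev_hoelder hn hvC hvc hv0 hvS hSf
  have hSvol : volume.real S ≤ c * Y := by
    have h1 : volume.real S = ∫ x in S, (1:ℝ) := by simp
    rw [h1, hY, ← integral_const_mul]
    calc ∫ x in S, (1:ℝ) ≤ ∫ x in S, c * sqp (z x - k) := by
          refine setIntegral_mono_on (integrableOn_const hSf) ((iY.mono_set hSB).const_mul c) hSm
            fun x hx => hgap x hx.2
      _ ≤ ∫ x in B, c * sqp (z x - k) := by
          refine setIntegral_mono_set (iY.const_mul c)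
            (Filter.Eventually.of_forall fun x => mul_nonneg hc0 (sqp_nonneg _))
            (Filter.Eventually.of_forall hSB)
  have hDv : ∀ x, fderiv ℝ v x = (η x ^ 2) • ((2 * max (z x - k') 0) • fderiv ℝ z x) +
      sqp (z x - k') • ((2 * η x) • fderiv ℝ η x) := by
    intro x
    have h4 : HasFDerivAt (fun x => η x ^ 2) ((2 * η x) • fderiv ℝ η x) x := by
      have := ((hηC.differentiable (by norm_num)) x).hasFDerivAt.pow 2
      simpa using this
    have h5 : HasFDerivAt v _ x := h4.mul (hasFDerivAt_sqp_comp hzC k' x)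
    exact h5.fderiv
  have i1 : Integrable (fun x => η x ^ 2 * sqp (z x - k') * ‖fderiv ℝ z x‖ ^ 2) :=
    Continuous.integrable_of_hasCompactSupport (by fun_prop) hη2.mul_right.mul_right
  have i2 : Integrable (fun x => sqp (z x - k') * ‖fderiv ℝ η x‖ ^ 2) :=
    Continuous.integrable_of_hasCompactSupport (by fun_prop) hDη2.mul_left
  have i3 : Integrable (fun x => η x ^ 2 * sqp (z x - k')) := ivv
  have i4 : Integrable (fun x => η x ^ 2 * sqp (z x - k)) :=
    Continuous.integrable_of_hasCompactSupport (by fun_prop) hη2.mul_right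
  have i5 : Integrable (fun x => η x ^ 2 * sqp (z x - k') * ‖fderiv ℝ z x‖ ^ 2 +
      c * (η x ^ 2 * sqp (z x - k))) := i1.add (i4.const_mul c)
  have i6 : Integrable (fun x => η x ^ 2 * sqp (z x - k') + sqp (z x - k') * ‖fderiv ℝ η x‖ ^ 2) :=
    i3.add i2
  have b2 : ∫ x, sqp (z x - k') * ‖fderiv ℝ η x‖ ^ 2 ≤ 16 * L ^ 4 * Y := by
    refine comp _ _ i2 (fun x hx => by simp [hDη0 x hx]) fun x => ?_
    rw [mul_comm]
    exact mul_le_mul (hDηle x) (hmono x) (sqp_nonneg _) (by positivity)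
  have b3 : ∫ x, η x ^ 2 * sqp (z x - k') ≤ L ^ 4 * Y := by
    refine comp _ _ i3 (fun x hx => by simp [hη0 x hx]) fun x => ?_
    exact mul_le_mul (hηle x) (hmono x) (sqp_nonneg _) (by positivity)
  have b4 : ∫ x, η x ^ 2 * sqp (z x - k) ≤ L ^ 4 * Y := by
    refine comp _ _ i4 (fun x hx => by simp [hη0 x hx]) fun x => ?_
    exact mul_le_mul_of_nonneg_right (hηle x) (sqp_nonneg _)
  have hgrad : ∫ x, ‖fderiv ℝ v x‖ ≤
      (∫ x, η x ^ 2 * sqp (z x - k') * ‖fderiv ℝ z x‖ ^ 2) +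
      c * (∫ x, η x ^ 2 * sqp (z x - k)) +
      ((∫ x, η x ^ 2 * sqp (z x - k')) + ∫ x, sqp (z x - k') * ‖fderiv ℝ η x‖ ^ 2) := by
    rw [← integral_const_mul, ← integral_add i1 (i4.const_mul _), ← integral_add i3 i2,
      ← integral_add i5 i6]
    refine integral_mono ?_ (i5.add i6) fun x => ?_
    · exact (((hvC.continuous_fderiv (by norm_num))).integrable_of_hasCompactSupport
        (hvc.fderiv (𝕜 := ℝ))).norm
    simp only
    rw [hDv]
    refine (norm_add_le _ _).trans ?_
    simp only [norm_smul, Real.norm_eq_abs]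
    have hm : 0 ≤ max (z x - k') 0 := le_max_right _ _
    rw [abs_of_nonneg (sq_nonneg (η x)), abs_of_nonneg (sqp_nonneg _),
      abs_of_nonneg (by positivity), abs_of_nonneg (mul_nonneg zero_le_two (hηn x))]
    apply add_le_add
    · rcases le_or_gt (z x) k' with hzk | hzk
      · rw [max_eq_right (by linarith)]
        have := sqp_nonneg (z x - k)
        have := sqp_nonneg (z x - k')
        simp only [mul_zero, zero_mul]
        positivity
      · have g := hgap x hzk
        have e : sqp (z x - k') = (max (z x - k') 0) ^ 2 := rfl
        rw [e]
        set m := max (z x - k') 0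
        set D := ‖fderiv ℝ z x‖
        have h1 : 2 * m * D ≤ m ^ 2 * D ^ 2 + c * sqp (z x - k) := by nlinarith [sq_nonneg (m * D - 1)]
        have h2 := mul_le_mul_of_nonneg_left h1 (sq_nonneg (η x))
        nlinarith
    · have h1 := two_mul_le_add_sq (η x) ‖fderiv ℝ η x‖
      have h2 := mul_le_mul_of_nonneg_left h1 (sqp_nonneg (z x - k'))
      nlinarith
  have hgrad2 : ∫ x, ‖fderiv ℝ v x‖ ≤ 84 * Λ ^ 2 * L ^ 4 * (1 + c) * Y := by
    have h1 : ∫ x, ‖fderiv ℝ v x‖ ≤ (4 * Λ ^ 2 * (16 * L ^ 4 * Y) + 2 * Λ * (L ^ 4 * Y)) +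
        c * (L ^ 4 * Y) + (L ^ 4 * Y + 16 * L ^ 4 * Y) := by
      refine hgrad.trans ?_
      gcongr
      refine cac.trans ?_
      gcongr
    refine h1.trans ?_
    have hX : 0 ≤ L ^ 4 * Y := by positivity
    set X := L ^ 4 * Y
    have e1 : 4 * Λ ^ 2 * (16 * L ^ 4 * Y) + 2 * Λ * X + c * X + (X + 16 * L ^ 4 * Y) =
      (64 * Λ ^ 2 + 2 * Λ + c + 17) * X := by simp only [X]; ring
    have e2 : 84 * Λ ^ 2 * L ^ 4 * (1 + c) * Y = (84 * Λ ^ 2 * (1 + c)) * X := by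
      simp only [X]; ring
    rw [e1, e2]
    apply mul_le_mul_of_nonneg_right _ hX
    have h3 : 1 ≤ Λ ^ 2 := by nlinarith
    have h4 : Λ ≤ Λ ^ 2 := by nlinarith
    have h5 : 1 * c ≤ Λ ^ 2 * c := mul_le_mul_of_nonneg_right h3 hc0
    have h6 : 0 ≤ Λ ^ 2 * c := by positivity
    linarith
  calc _ ≤ ∫ x, v x := hleft
    _ ≤ sobC n * (∫ x, ‖fderiv ℝ v x‖) * (volume.real S) ^ (1 / (n : ℝ)) := sob
    _ ≤ _ := by
      have := sobC_nonneg n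
      gcongr

theorem fast_decay {n : ℕ} (hn : 2 ≤ n) {C1 C2 : ℝ} (hC1 : 0 ≤ C1) (hC2 : 0 < C2) :
    ∃ K : ℝ, 1 ≤ K ∧ ∀ Y : ℕ → ℝ, (∀ j, 0 ≤ Y j) → Y 0 ≤ C1 →
      (∀ j, Y (j + 1) ≤ C2 * 256 ^ j * Y j * (Y j / K ^ 2) ^ (1 / (n : ℝ))) →
      ∀ j, Y j ≤ C1 * (((256 : ℝ)⁻¹) ^ n) ^ j := by
  have hn0 : n ≠ 0 := by omega
  set q : ℝ := ((256 : ℝ)⁻¹) ^ n with hq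
  have hq0 : 0 < q := by positivity
  set ε : ℝ := (q / C2) ^ n with hε
  have hε0 : 0 < ε := by positivity
  refine ⟨max 1 (C1 / ε), le_max_left _ _, fun Y hY0 hY1 hY j => ?_⟩
  set K := max 1 (C1 / ε) with hK
  have hK1 : 1 ≤ K := le_max_left _ _
  have hKε : C1 / K ^ 2 ≤ ε := by
    have h1 : C1 / ε ≤ K := le_max_right _ _
    rw [div_le_iff₀ (by positivity)]
    rw [div_le_iff₀ hε0] at h1
    have : K ≤ K ^ 2 := by nlinarith
    nlinarith
  induction j with
  | zero => simpa using hY1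
  | succ j ih =>
    have h1 : (Y j / K ^ 2) ^ (1 / (n : ℝ)) ≤ (q / C2) * ((256 : ℝ)⁻¹) ^ j := by
      have h2 : Y j / K ^ 2 ≤ ((q / C2) * ((256 : ℝ)⁻¹) ^ j) ^ n := by
        calc Y j / K ^ 2 ≤ C1 * q ^ j / K ^ 2 := by gcongr
          _ = C1 / K ^ 2 * q ^ j := by ring
          _ ≤ ε * q ^ j := by gcongr
          _ = _ := by rw [hε, hq, mul_pow, ← pow_mul, ← pow_mul, mul_comm n j]
      calc (Y j / K ^ 2) ^ (1 / (n : ℝ)) ≤ (((q / C2) * ((256 : ℝ)⁻¹) ^ j) ^ n) ^ (1 / (n : ℝ)) := by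
            apply Real.rpow_le_rpow _ h2 (by positivity)
            have := hY0 j
            positivity
        _ = _ := by
            rw [one_div, Real.pow_rpow_inv_natCast (by positivity) hn0]
    calc Y (j + 1) ≤ C2 * 256 ^ j * Y j * (Y j / K ^ 2) ^ (1 / (n : ℝ)) := hY j
      _ ≤ C2 * 256 ^ j * (C1 * q ^ j) * ((q / C2) * ((256 : ℝ)⁻¹) ^ j) := by
          have := hY0 j
          gcongr
      _ = C1 * q ^ (j + 1) * (256 ^ j * ((256 : ℝ)⁻¹) ^ j) := by
          rw [pow_succ]; field_simp
      _ = C1 * q ^ (j + 1) := by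
          rw [← mul_pow, mul_inv_cancel₀ (by norm_num), one_pow, mul_one]

set_option maxHeartbeats 1000000 in
theorem growth_lemma (n : ℕ) (hn : 2 ≤ n) (Λ : ℝ) (hΛ : 1 ≤ Λ) :
    ∃ K : ℝ, 1 ≤ K ∧ ∀ b : EE n → DD n →L[ℝ] DD n →L[ℝ] ℝ, Ell n Λ b →
      ∀ w : EE n → ℝ, ContDiff ℝ 1 w → (∀ x, 0 ≤ w x) → ∀ δ : ℝ, 0 < δ → SuperSol n b w δ →
      ∀ h : ℝ, 0 ≤ h →
      volume (ball (0 : EE n) (3/4)) ≤ 2 * volume {x ∈ ball (0 : EE n) (3/4) | h ≤ w x} →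
      ∀ x ∈ ball (0 : EE n) (1/2), Real.exp (-K) * h ≤ w x + δ := by
  have hC1 : 0 ≤ initC n Λ := by
    unfold initC
    have h1 : 0 ≤ ∫ x : EE n, 1 * ‖fderiv ℝ (cut 16 (13/16) : EE n → ℝ) x‖ ^ 2 :=
      integral_nonneg fun x => by positivity
    have h2 : 0 ≤ ∫ x : EE n, cut 16 (13/16) x ^ 2 * 1 :=
      integral_nonneg fun x => by positivity
    positivity
  set C2 : ℝ := (sobC n + 1) * (84 * Λ ^ 2) * 2 ^ 17 with hC2
  have hS0 := sobC_nonneg n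
  have hC20 : 0 < C2 := by positivity
  obtain ⟨K, hK1, hK⟩ := fast_decay hn hC1 hC20
  refine ⟨K, hK1, ?_⟩
  intro b hb w hw hw0 δ hδ hs h hh hvol
  set z : EE n → ℝ := fun x => Real.log (h + δ) - Real.log (w x + δ) with hz
  have hwp : ∀ x, 0 < w x + δ := fun x => by linarith [hw0 x]
  have hwd : ContDiff ℝ 1 (fun x => w x + δ) := hw.add contDiff_const
  have hzC : ContDiff ℝ 1 z := contDiff_const.sub (hwd.log fun x => (hwp x).ne')
  have hGC : ∀ k, Continuous (fun x => sqp (z x - k)) :=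
    fun k => (contDiff_sqp.comp (hzC.sub contDiff_const)).continuous
  set r : ℕ → ℝ := fun j => 1/2 + (1/2) ^ (j + 2) with hr
  set k : ℕ → ℝ := fun j => K * (1 - (1/2) ^ j) with hk
  set Y : ℕ → ℝ := fun j => ∫ x in ball (0 : EE n) (r j), sqp (z x - k j) with hY
  have hY0 : ∀ j, 0 ≤ Y j := fun j => integral_nonneg fun x => sqp_nonneg _
  have hYi : Y 0 ≤ initC n Λ := by
    have := init_bound hΛ hb hw hw0 hδ hs hh hvol hz
    have e1 : r 0 = 3/4 := by simp only [hr]; norm_num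
    have e2 : k 0 = 0 := by simp only [hk]; norm_num
    simp only [hY, e1, e2]
    exact this
  have hYs : ∀ j, Y (j + 1) ≤ C2 * 256 ^ j * Y j * (Y j / K ^ 2) ^ (1 / (n : ℝ)) := by
    intro j
    set t : ℝ := (1/2) ^ j with ht
    have ht0 : 0 < t := by positivity
    have ht1 : t ≤ 1 := pow_le_one₀ (by norm_num) (by norm_num)
    set T : ℝ := 2 ^ j with hT
    have hT1 : 1 ≤ T := one_le_pow₀ (by norm_num)
    have hTt : T * t = 1 := by rw [hT, ht, ← mul_pow]; norm_num
    have e1 : r j = 1/2 + t / 4 := by simp only [hr, ht, pow_add]; ring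
    have e2 : r (j + 1) = 1/2 + t / 8 := by simp only [hr, ht, pow_add]; ring
    have e3 : k (j + 1) - k j = K * (t / 2) := by simp only [hk, ht, pow_add]; ring
    have st := degiorgi_step hn hΛ hb hw hw0 hδ hs hz (r := r j) (r' := r (j + 1)) (k := k j)
      (k' := k (j + 1)) (L := 8 * T) (by rw [e2]; positivity) (by rw [e1, e2]; linarith)
      (by rw [e1]; linarith) (by linarith) (by
        rw [e1, e2]
        have : 8 * T * ((1 / 2 + t / 4) ^ 2 - (1 / 2 + t / 8) ^ 2) =
          (T * t) + (T * t) * (3/8) * t := by ring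
        rw [this, hTt]; nlinarith)
      (by have : 0 < K * (t / 2) := by positivity
          linarith)
    have e4 : ((k (j + 1) - k j) ^ 2)⁻¹ = 4 * T ^ 2 / K ^ 2 := by
      rw [e3]
      have : t = T⁻¹ := eq_inv_of_mul_eq_one_right hTt
      rw [this]; field_simp; norm_num
    rw [e4] at st
    change Y (j + 1) ≤ sobC n * (84 * Λ ^ 2 * (8 * T) ^ 4 * (1 + 4 * T ^ 2 / K ^ 2) * Y j) *
      (4 * T ^ 2 / K ^ 2 * Y j) ^ (1 / (n : ℝ)) at st
    refine st.trans ?_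
    have y0 := hY0 j
    have f1 : 1 + 4 * T ^ 2 / K ^ 2 ≤ 8 * T ^ 2 := by
      have : 4 * T ^ 2 / K ^ 2 ≤ 4 * T ^ 2 := div_le_self (by positivity) (by nlinarith)
      nlinarith
    have f2 : (4 * T ^ 2 / K ^ 2 * Y j) ^ (1 / (n : ℝ)) ≤
        4 * T ^ 2 * (Y j / K ^ 2) ^ (1 / (n : ℝ)) := by
      rw [show 4 * T ^ 2 / K ^ 2 * Y j = (4 * T ^ 2) * (Y j / K ^ 2) by ring,
        Real.mul_rpow (by positivity) (by positivity)]
      gcongr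
      calc (4 * T ^ 2) ^ (1 / (n : ℝ)) ≤ (4 * T ^ 2) ^ (1 : ℝ) := by
            apply Real.rpow_le_rpow_of_exponent_le
            · nlinarith
            · rw [div_le_one (by positivity)]
              exact_mod_cast (by omega : 1 ≤ n)
        _ = _ := Real.rpow_one _
    calc _ ≤ (sobC n + 1) * (84 * Λ ^ 2 * (8 * T) ^ 4 * (8 * T ^ 2) * Y j) *
          (4 * T ^ 2 * (Y j / K ^ 2) ^ (1 / (n : ℝ))) := by
          gcongr
          linarith
      _ = (sobC n + 1) * (84 * Λ ^ 2) * 2 ^ 17 * (T ^ 8) * Y j * (Y j / K ^ 2) ^ (1 / (n : ℝ)) := by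
          ring
      _ = _ := by
          rw [hC2, hT, ← pow_mul, mul_comm j 8, pow_mul]; norm_num
  have hdec := hK Y hY0 hYi hYs
  -- the limit
  have hlim : ∫ x in ball (0 : EE n) (1/2), sqp (z x - K) ≤ 0 := by
    have hle : ∀ j, ∫ x in ball (0 : EE n) (1/2), sqp (z x - K) ≤
        initC n Λ * (((256 : ℝ)⁻¹) ^ n) ^ j := by
      intro j
      refine le_trans ?_ (hdec j)
      have hsub : ball (0 : EE n) (1/2) ⊆ ball (0 : EE n) (r j) := ball_subset_ball (by
        simp only [hr]
        have : (0:ℝ) ≤ (1/2) ^ (j + 2) := by positivity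
        linarith)
      calc ∫ x in ball (0 : EE n) (1/2), sqp (z x - K)
          ≤ ∫ x in ball (0 : EE n) (1/2), sqp (z x - k j) := by
            refine integral_mono (integrableOn_ball_of_continuous (hGC K) _)
              (integrableOn_ball_of_continuous (hGC (k j)) _) fun x => ?_
            unfold sqp
            have hkK : k j ≤ K := by
              simp only [hk]
              have : (0:ℝ) ≤ (1/2) ^ j := by positivity
              nlinarith
            have : max (z x - K) 0 ≤ max (z x - k j) 0 := max_le_max (by linarith) le_rfl
            exact pow_le_pow_left₀ (le_max_right _ _) this 2
        _ ≤ Y j := setIntegral_mono_set (integrableOn_ball_of_continuous (hGC (k j)) _)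
            (Filter.Eventually.of_forall fun x => sqp_nonneg _)
            (Filter.Eventually.of_forall hsub)
    have ht : Filter.Tendsto (fun j : ℕ => initC n Λ * (((256 : ℝ)⁻¹) ^ n) ^ j) Filter.atTop
        (nhds (initC n Λ * 0)) := by
      apply Filter.Tendsto.const_mul
      apply tendsto_pow_atTop_nhds_zero_of_lt_one (by positivity)
      exact pow_lt_one₀ (by norm_num) (by norm_num) (by omega)
    rw [mul_zero] at ht
    exact ge_of_tendsto' ht hle
  have hae : ∀ᵐ x ∂(volume.restrict (ball (0 : EE n) (1/2))), sqp (z x - K) = 0 := by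
    have h0 : ∫ x in ball (0 : EE n) (1/2), sqp (z x - K) = 0 :=
      le_antisymm hlim (integral_nonneg fun x => sqp_nonneg _)
    exact (integral_eq_zero_iff_of_nonneg (fun x => sqp_nonneg _)
      (integrableOn_ball_of_continuous (hGC K) _)).mp h0
  have heq : EqOn (fun x => sqp (z x - K)) (fun _ => 0) (ball (0 : EE n) (1/2)) :=
    Measure.eqOn_open_of_ae_eq hae isOpen_ball (hGC K).continuousOn continuousOn_const
  intro x hx
  have h1 : sqp (z x - K) = 0 := heq hx
  have h2 : z x ≤ K := by
    by_contra hc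
    push Not at hc
    rw [sqp_of_nonneg (by linarith)] at h1
    have : 0 < z x - K := by linarith
    have : 0 < (z x - K) ^ 2 := by positivity
    linarith
  have hhp : 0 < h + δ := by linarith
  have h3 : Real.log (h + δ) - K ≤ Real.log (w x + δ) := by simp only [hz] at h2; linarith
  have h4 := Real.exp_le_exp.mpr h3
  rw [Real.exp_log (hwp x), sub_eq_add_neg, Real.exp_add, Real.exp_log hhp] at h4
  have := Real.exp_pos (-K)
  nlinarith

def WeakEq (n : ℕ) (b : EE n → DD n →L[ℝ] DD n →L[ℝ] ℝ) (φ R : EE n → ℝ) : Prop :=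
  ∀ ψ : EE n → ℝ, ContDiff ℝ 1 ψ → HasCompactSupport ψ → tsupport ψ ⊆ ball 0 (7/8) →
    ∫ x, b x (fderiv ℝ φ x) (fderiv ℝ ψ x) = ∫ x, R x * ψ x

theorem superSol_of_weakEq {n : ℕ} {Λ : ℝ} (hΛ : 1 ≤ Λ) {b : EE n → DD n →L[ℝ] DD n →L[ℝ] ℝ}
    (hb : Ell n Λ b) {φ R : EE n → ℝ} (hφ : ContDiff ℝ 1 φ) (hR : Continuous R) {m D : ℝ}
    (hD : 0 < D) (hm : ∀ x, m ≤ φ x)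
    (hRb : ∀ x ∈ ball (0 : EE n) (7/8), -(2 * ‖fderiv ℝ φ x‖ ^ 2 + D) ≤ R x)
    (hw : WeakEq n b φ R) :
    SuperSol n b (fun x => 1 - Real.exp (-(2 * Λ * (φ x - m)))) (2 * Λ * D) := by
  intro ζ hζ hζc hζs hζ0
  have hΛ0 : 0 < Λ := by linarith
  set e : EE n → ℝ := fun x => Real.exp (-(2 * Λ * (φ x - m))) with he
  have heC : ContDiff ℝ 1 e :=
    Real.contDiff_exp.comp ((contDiff_const.mul (hφ.sub contDiff_const)).neg)
  have he0 : ∀ x, 0 < e x := fun x => Real.exp_pos _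
  have he1 : ∀ x, e x ≤ 1 := fun x => by
    simp only [he]
    rw [Real.exp_le_one_iff]
    have := hm x
    have : 0 ≤ 2 * Λ * (φ x - m) := mul_nonneg (by positivity) (by linarith)
    linarith
  have hDe : ∀ x, HasFDerivAt e (-(2 * Λ * e x) • fderiv ℝ φ x) x := fun x => by
    have h1 : HasFDerivAt (fun x => -(2 * Λ * (φ x - m))) (-((2 * Λ) • fderiv ℝ φ x)) x :=
      ((((hφ.differentiable (by norm_num)) x).hasFDerivAt.sub_const m).const_mul (2 * Λ)).neg
    have h2 : HasFDerivAt e _ x := h1.exp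
    have h3 : -(2 * Λ * e x) • fderiv ℝ φ x =
        Real.exp (-(2 * Λ * (φ x - m))) • -((2 * Λ) • fderiv ℝ φ x) := by
      rw [smul_neg, smul_smul, ← neg_smul]
      congr 1
      simp only [he]
      ring
    rw [h3]
    exact h2
  have hDw : ∀ x, fderiv ℝ (fun x => 1 - e x) x = (2 * Λ * e x) • fderiv ℝ φ x := fun x => by
    have h : HasFDerivAt (fun x => 1 - e x) _ x := (hDe x).const_sub 1
    rw [h.fderiv, neg_smul, neg_neg]
  set ψ : EE n → ℝ := fun x => ζ x * (2 * Λ * e x) with hψ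
  have hψC : ContDiff ℝ 1 ψ := hζ.mul (contDiff_const.mul heC)
  have hψc : HasCompactSupport ψ := hζc.mul_right
  have hψs : tsupport ψ ⊆ ball 0 (7/8) := by
    refine (closure_mono ?_).trans hζs
    intro x hx h0
    apply hx
    simp [hψ, h0]
  have key := hw ψ hψC hψc hψs
  have hDψ : ∀ x, fderiv ℝ ψ x = (2 * Λ * e x) • fderiv ℝ ζ x -
      (4 * Λ ^ 2 * e x * ζ x) • fderiv ℝ φ x := fun x => by
    have h : HasFDerivAt ψ _ x :=
      ((hζ.differentiable (by norm_num)) x).hasFDerivAt.mul ((hDe x).const_mul (2 * Λ))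
    rw [h.fderiv]
    ext v
    simp only [ContinuousLinearMap.add_apply, ContinuousLinearMap.sub_apply,
      ContinuousLinearMap.smul_apply, smul_eq_mul]
    ring
  have hDφc : Continuous (fun x => fderiv ℝ φ x) := hφ.continuous_fderiv (by norm_num)
  have hDζc : Continuous (fun x => fderiv ℝ ζ x) := hζ.continuous_fderiv (by norm_num)
  have hDψc : Continuous (fun x => fderiv ℝ ψ x) := hψC.continuous_fderiv (by norm_num)
  have hbc := hb.cont
  have hec := heC.continuous
  have hζcont := hζ.continuous
  have hψcont := hψC.continuous
  have i1 : Integrable (fun x => b x (fderiv ℝ φ x) (fderiv ℝ ψ x)) := by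
    apply Continuous.integrable_of_hasCompactSupport (by fun_prop)
    refine (hψc.fderiv (𝕜 := ℝ)).mono' ?_
    intro x hx
    apply subset_tsupport
    intro h0
    apply hx
    simp only [h0, map_zero]
  have i2 : Integrable (fun x => R x * ψ x) :=
    Continuous.integrable_of_hasCompactSupport (by fun_prop) hψc.mul_left
  have i3 : Integrable (fun x => ζ x * (4 * Λ ^ 2 * e x * b x (fderiv ℝ φ x) (fderiv ℝ φ x))) :=
    Continuous.integrable_of_hasCompactSupport (by fun_prop) hζc.mul_right
  have i4 : Integrable ζ := hζcont.integrable_of_hasCompactSupport hζc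
  have e1 : ∫ x, b x (fderiv ℝ (fun x => 1 - e x) x) (fderiv ℝ ζ x) =
      (∫ x, R x * ψ x) + ∫ x, ζ x * (4 * Λ ^ 2 * e x * b x (fderiv ℝ φ x) (fderiv ℝ φ x)) := by
    rw [← key, ← integral_add i1 i3]
    refine integral_congr_ae (Filter.Eventually.of_forall fun x => ?_)
    simp only
    rw [hDw, hDψ]
    simp only [map_sub, map_smul, ContinuousLinearMap.smul_apply, smul_eq_mul]
    ring
  rw [e1, ← integral_add i2 i3, ← integral_const_mul, ← integral_neg]
  refine integral_mono (i4.const_mul _).neg (i2.add i3) fun x => ?_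
  simp only [hψ]
  by_cases hx : x ∈ ball (0 : EE n) (7/8)
  · have h1 := hRb x hx
    have h2 := hb.lower x (fderiv ℝ φ x)
    have z0 := hζ0 x
    have ex0 := he0 x
    have ex1 := he1 x
    set B := b x (fderiv ℝ φ x) (fderiv ℝ φ x)
    set N := ‖fderiv ℝ φ x‖ ^ 2
    have h3 : N ≤ Λ * B := by
      rw [inv_mul_le_iff₀ hΛ0] at h2; exact h2
    have h4 : 0 ≤ 2 * Λ * (ζ x * e x) := by positivity
    have h5 : -D ≤ R x + 2 * Λ * B := by linarith
    have h6 := mul_le_mul_of_nonneg_left h5 h4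
    have h7 : 0 ≤ 2 * Λ * D * ζ x * (1 - e x) := by
      apply mul_nonneg (by positivity); linarith
    nlinarith
  · have : ζ x = 0 := by
      by_contra hc
      exact hx (hζs (subset_tsupport _ hc))
    simp [this]

theorem half_bound {n : ℕ} {Λ : ℝ} (hΛ : 1 ≤ Λ) {K : ℝ}
    (hK : ∀ b : EE n → DD n →L[ℝ] DD n →L[ℝ] ℝ, Ell n Λ b →
      ∀ w : EE n → ℝ, ContDiff ℝ 1 w → (∀ x, 0 ≤ w x) → ∀ δ : ℝ, 0 < δ → SuperSol n b w δ →
      ∀ h : ℝ, 0 ≤ h →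
      volume (ball (0 : EE n) (3/4)) ≤ 2 * volume {x ∈ ball (0 : EE n) (3/4) | h ≤ w x} →
      ∀ x ∈ ball (0 : EE n) (1/2), Real.exp (-K) * h ≤ w x + δ)
    {b : EE n → DD n →L[ℝ] DD n →L[ℝ] ℝ}
    (hb : Ell n Λ b) {φ R : EE n → ℝ} (hφ : ContDiff ℝ 1 φ) (hR : Continuous R) {m D κ ω : ℝ}
    (hD : 0 < D) (hm : ∀ x, m ≤ φ x) (hω : 0 ≤ ω) (hωκ : ω ≤ κ)
    (hRb : ∀ x ∈ ball (0 : EE n) (7/8), -(2 * ‖fderiv ℝ φ x‖ ^ 2 + D) ≤ R x)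
    (hw : WeakEq n b φ R)
    (hvol : volume (ball (0 : EE n) (3/4)) ≤
      2 * volume {x ∈ ball (0 : EE n) (3/4) | m + ω / 2 ≤ φ x}) :
    ∀ x ∈ ball (0 : EE n) (1/2), m + (1/2) * (Real.exp (-K) * Real.exp (-(Λ * κ))) * ω - D ≤ φ x := by
  intro x hx
  have hΛ0 : 0 < Λ := by linarith
  have hs := superSol_of_weakEq hΛ hb hφ hR hD hm hRb hw
  have hwC : ContDiff ℝ 1 (fun x => 1 - Real.exp (-(2 * Λ * (φ x - m)))) :=
    contDiff_const.sub (Real.contDiff_exp.comp ((contDiff_const.mul (hφ.sub contDiff_const)).neg))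
  have hmono : ∀ s t : ℝ, s ≤ t → 1 - Real.exp (-(2 * Λ * s)) ≤ 1 - Real.exp (-(2 * Λ * t)) := by
    intro s t hst
    have : Real.exp (-(2 * Λ * t)) ≤ Real.exp (-(2 * Λ * s)) := by
      apply Real.exp_le_exp.mpr
      have : 2 * Λ * s ≤ 2 * Λ * t := mul_le_mul_of_nonneg_left hst (by positivity)
      linarith
    linarith
  have hw0 : ∀ x, 0 ≤ 1 - Real.exp (-(2 * Λ * (φ x - m))) := fun x => by
    have := hmono 0 (φ x - m) (by linarith [hm x])
    simpa using this
  have hh0 : 0 ≤ 1 - Real.exp (-(2 * Λ * (ω / 2))) := by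
    have := hmono 0 (ω / 2) (by linarith)
    simpa using this
  have g := hK b hb _ hwC hw0 (2 * Λ * D) (by positivity) hs _ hh0 (by
    refine hvol.trans ?_
    gcongr 2 * volume ?_
    intro y hy
    exact ⟨hy.1, hmono _ _ (by linarith [hy.2])⟩) x hx
  have a1 : 1 - Real.exp (-(2 * Λ * (φ x - m))) ≤ 2 * Λ * (φ x - m) := by
    have := Real.add_one_le_exp (-(2 * Λ * (φ x - m)))
    linarith
  have a2 : Λ * ω * Real.exp (-(Λ * κ)) ≤ 1 - Real.exp (-(2 * Λ * (ω / 2))) := by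
    have h1 : Real.exp (-(Λ * κ)) ≤ Real.exp (-(Λ * ω)) := by
      apply Real.exp_le_exp.mpr
      have : Λ * ω ≤ Λ * κ := mul_le_mul_of_nonneg_left hωκ hΛ0.le
      linarith
    have h2 := Real.add_one_le_exp (Λ * ω)
    have h3 : Real.exp (Λ * ω) * Real.exp (-(Λ * ω)) = 1 := by
      rw [← Real.exp_add]; simp
    have h4 := Real.exp_pos (-(Λ * ω))
    have h5 : 0 ≤ Λ * ω := by positivity
    rw [show 2 * Λ * (ω / 2) = Λ * ω by ring]
    calc Λ * ω * Real.exp (-(Λ * κ)) ≤ Λ * ω * Real.exp (-(Λ * ω)) :=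
          mul_le_mul_of_nonneg_left h1 h5
      _ ≤ _ := by nlinarith
  have a3 := mul_le_mul_of_nonneg_left a2 (Real.exp_pos (-K)).le
  have a4 : Real.exp (-K) * (Λ * ω * Real.exp (-(Λ * κ))) ≤ 2 * Λ * (φ x - m) + 2 * Λ * D := by
    linarith
  have a5 : (2 * Λ) * ((1/2) * (Real.exp (-K) * Real.exp (-(Λ * κ))) * ω) ≤
      (2 * Λ) * (φ x - m + D) := by
    calc _ = Real.exp (-K) * (Λ * ω * Real.exp (-(Λ * κ))) := by ring
      _ ≤ _ := by linarith
  have a6 := le_of_mul_le_mul_left a5 (by positivity)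
  linarith

theorem osc_abs {n : ℕ} {Λ : ℝ} (hΛ : 1 ≤ Λ) {K : ℝ}
    (hK : ∀ b : EE n → DD n →L[ℝ] DD n →L[ℝ] ℝ, Ell n Λ b →
      ∀ w : EE n → ℝ, ContDiff ℝ 1 w → (∀ x, 0 ≤ w x) → ∀ δ : ℝ, 0 < δ → SuperSol n b w δ →
      ∀ h : ℝ, 0 ≤ h →
      volume (ball (0 : EE n) (3/4)) ≤ 2 * volume {x ∈ ball (0 : EE n) (3/4) | h ≤ w x} →
      ∀ x ∈ ball (0 : EE n) (1/2), Real.exp (-K) * h ≤ w x + δ)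
    {b : EE n → DD n →L[ℝ] DD n →L[ℝ] ℝ}
    (hb : Ell n Λ b) {φ R : EE n → ℝ} (hφ : ContDiff ℝ 1 φ) (hR : Continuous R) {m M D κ : ℝ}
    (hD : 0 < D) (hm : ∀ x, m ≤ φ x) (hM : ∀ x, φ x ≤ M) (hωκ : M - m ≤ κ)
    (hRb : ∀ x ∈ ball (0 : EE n) (7/8), |R x| ≤ 2 * ‖fderiv ℝ φ x‖ ^ 2 + D)
    (hw : WeakEq n b φ R) :
    (∀ x ∈ ball (0 : EE n) (1/2),
      m + (1/2) * (Real.exp (-K) * Real.exp (-(Λ * κ))) * (M - m) - D ≤ φ x) ∨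
    (∀ x ∈ ball (0 : EE n) (1/2),
      φ x ≤ M - (1/2) * (Real.exp (-K) * Real.exp (-(Λ * κ))) * (M - m) + D) := by
  have hω : 0 ≤ M - m := by linarith [hm 0, hM 0]
  set S1 := {x ∈ ball (0 : EE n) (3/4) | m + (M - m) / 2 ≤ φ x} with hS1
  set S2 := {x ∈ ball (0 : EE n) (3/4) | -M + (M - m) / 2 ≤ -φ x} with hS2
  have hcov : ball (0 : EE n) (3/4) ⊆ S1 ∪ S2 := by
    intro x hx
    rcases le_total (m + (M - m) / 2) (φ x) with h | h
    · exact Or.inl ⟨hx, h⟩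
    · exact Or.inr ⟨hx, by linarith⟩
  have hvol : volume (ball (0 : EE n) (3/4)) ≤ volume S1 + volume S2 :=
    (measure_mono hcov).trans (measure_union_le _ _)
  rcases le_total (volume S2) (volume S1) with h | h
  · left
    refine half_bound hΛ hK hb hφ hR hD hm hω hωκ (fun x hx => ?_) hw ?_
    · exact (abs_le.mp (hRb x hx)).1
    · refine hvol.trans ?_
      rw [two_mul]
      gcongr
  · right
    have hf : ∀ x, fderiv ℝ (fun x => -φ x) x = -fderiv ℝ φ x := fun x => fderiv_fun_neg
    have := half_bound hΛ hK hb (φ := fun x => -φ x) (R := fun x => -R x) hφ.neg hR.neg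
      (m := -M) hD (fun x => by linarith [hM x]) hω hωκ (fun x hx => by
        rw [hf, norm_neg]
        have := (abs_le.mp (hRb x hx)).2
        linarith) (fun ψ h1 h2 h3 => by
          have := hw ψ h1 h2 h3
          simp only [hf, map_neg, ContinuousLinearMap.neg_apply, neg_mul, integral_neg, this]) (by
          refine hvol.trans ?_
          rw [two_mul]
          gcongr)
    intro x hx
    have := this x hx
    linarith

open scoped Convolution in
theorem exists_smooth_approx {n : ℕ} {ψ : EE n → ℝ} (hψ : ContDiff ℝ 1 ψ)
    (hc : HasCompactSupport ψ) (hs : tsupport ψ ⊆ ball 0 (7/8)) {ε : ℝ} (hε : 0 < ε) :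
    ∃ g : EE n → ℝ, ContDiff ℝ (⊤ : ℕ∞) g ∧ HasCompactSupport g ∧ tsupport g ⊆ ball 0 (7/8) ∧
      (∀ x, |g x - ψ x| ≤ ε) ∧ ∀ x, ‖fderiv ℝ g x - fderiv ℝ ψ x‖ ≤ ε := by
  have hDc : Continuous (fderiv ℝ ψ) := hψ.continuous_fderiv (by norm_num)
  have u1 : UniformContinuous ψ := hc.uniformContinuous_of_continuous hψ.continuous
  have u2 : UniformContinuous (fderiv ℝ ψ) :=
    (hc.fderiv (𝕜 := ℝ)).uniformContinuous_of_continuous hDc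
  obtain ⟨d1, d1p, h1⟩ := Metric.uniformContinuous_iff.mp u1 ε hε
  obtain ⟨d2, d2p, h2⟩ := Metric.uniformContinuous_iff.mp u2 ε hε
  obtain ⟨d3, d3p, h3⟩ := hc.isCompact.exists_cthickening_subset_open isOpen_ball hs
  set d := min d1 (min d2 d3) with hd
  have dp : 0 < d := lt_min d1p (lt_min d2p d3p)
  let bump : ContDiffBump (0 : EE n) := ⟨d / 2, d, by linarith, by linarith⟩
  have hout : bump.rOut = d := rfl
  set g : EE n → ℝ := (bump.normed volume ⋆[ContinuousLinearMap.lsmul ℝ ℝ, volume] ψ) with hg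
  have hsub : tsupport g ⊆ cthickening d3 (tsupport ψ) := by
    refine closure_minimal ?_ isClosed_cthickening
    refine (support_convolution_subset_swap _).trans ?_
    rintro x ⟨y, hy, z, hz, rfl⟩
    rw [bump.support_normed_eq, hout, mem_ball_zero_iff] at hz
    refine mem_cthickening_of_dist_le _ y _ _ (subset_tsupport _ hy) ?_
    rw [dist_eq_norm]
    simp only [add_sub_cancel_left]
    exact hz.le.trans ((min_le_right _ _).trans (min_le_right _ _))
  refine ⟨g, ?_, ?_, hsub.trans h3, ?_, ?_⟩
  · exact bump.hasCompactSupport_normed.contDiff_convolution_left _ bump.contDiff_normed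
      hψ.continuous.locallyIntegrable
  · exact (hc.isCompact.cthickening).of_isClosed_subset (isClosed_tsupport _) hsub
  · intro x
    rw [← Real.dist_eq]
    refine bump.dist_normed_convolution_le hψ.continuous.aestronglyMeasurable fun y hy => ?_
    exact (h1 (lt_of_lt_of_le hy (min_le_left _ _))).le
  · intro x
    have hf : HasFDerivAt g _ x := hc.hasFDerivAt_convolution_right
      (ContinuousLinearMap.lsmul ℝ ℝ) (bump.continuous_normed.locallyIntegrable) hψ x
    have he : ((bump.normed volume ⋆[(ContinuousLinearMap.lsmul ℝ ℝ).precompR (EE n), volume]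
        fderiv ℝ ψ) x) = (bump.normed volume ⋆[ContinuousLinearMap.lsmul ℝ ℝ, volume]
        fderiv ℝ ψ) x := by
      rfl
    rw [hf.fderiv, he, ← dist_eq_norm]
    refine bump.dist_normed_convolution_le hDc.aestronglyMeasurable fun y hy => ?_
    exact (h2 (lt_of_lt_of_le hy ((min_le_right _ _).trans (min_le_left _ _)))).le

theorem weakEq_of_smooth {n : ℕ} {b : EE n → DD n →L[ℝ] DD n →L[ℝ] ℝ} {φ R : EE n → ℝ}
    (hb : Continuous b) (hφ : ContDiff ℝ 1 φ) (hR : Continuous R)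
    (h : ∀ ψ : EE n → ℝ, ContDiff ℝ (⊤ : ℕ∞) ψ → HasCompactSupport ψ → tsupport ψ ⊆ ball 0 (7/8) →
      ∫ x, b x (fderiv ℝ φ x) (fderiv ℝ ψ x) = ∫ x, R x * ψ x) : WeakEq n b φ R := by
  intro ψ hψ hc hs
  set V : EE n → DD n →L[ℝ] ℝ := fun x => b x (fderiv ℝ φ x) with hV
  have hVc : Continuous V := hb.clm_apply (hφ.continuous_fderiv (by norm_num))
  set T : (EE n → ℝ) → ℝ := fun g => ∫ x, (V x (fderiv ℝ g x) - R x * g x) with hT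
  have hIntg : ∀ g : EE n → ℝ, ContDiff ℝ 1 g → HasCompactSupport g →
      Integrable (fun x => V x (fderiv ℝ g x)) ∧ Integrable (fun x => R x * g x) := by
    intro g hg hgc
    have hgc' := hg.continuous_fderiv (by norm_num)
    have := hg.continuous
    constructor
    · apply Continuous.integrable_of_hasCompactSupport (by fun_prop)
      refine (hgc.fderiv (𝕜 := ℝ)).mono' ?_
      intro x hx
      apply subset_tsupport
      intro h0
      apply hx
      simp only [h0, map_zero]
    · exact Continuous.integrable_of_hasCompactSupport (by fun_prop) hgc.mul_left
  have hψi := hIntg ψ hψ hc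
  set I : ℝ := ∫ x in ball (0 : EE n) (7/8), (‖V x‖ + |R x|) with hI
  have hIi : IntegrableOn (fun x => ‖V x‖ + |R x|) (ball (0 : EE n) (7/8)) :=
    integrableOn_ball_of_continuous (hVc.norm.add hR.abs) _
  have hI0 : 0 ≤ I := integral_nonneg fun x => by positivity
  have hTψ : ∀ ε : ℝ, 0 < ε → |T ψ| ≤ I * ε := by
    intro ε hε
    obtain ⟨g, g1, g2, g3, g4, g5⟩ := exists_smooth_approx hψ hc hs hε
    have g1' : ContDiff ℝ 1 g := g1.of_le (by exact_mod_cast le_top)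
    have hgi := hIntg g g1' g2
    have hTg : T g = 0 := by
      simp only [hT]
      rw [integral_sub hgi.1 hgi.2, h g g1 g2 g3, sub_self]
    have hz : ∀ g : EE n → ℝ, tsupport g ⊆ ball 0 (7/8) → ∀ x ∉ ball (0 : EE n) (7/8),
        g x = 0 ∧ fderiv ℝ g x = 0 := by
      intro g hg x hx
      refine ⟨image_eq_zero_of_notMem_tsupport fun h => hx (hg h), ?_⟩
      by_contra h0
      exact hx (hg (support_fderiv_subset ℝ h0))
    have hTd : T ψ = ∫ x in ball (0 : EE n) (7/8),
        ((V x (fderiv ℝ ψ x) - R x * ψ x) - (V x (fderiv ℝ g x) - R x * g x)) := by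
      rw [setIntegral_eq_integral_of_forall_compl_eq_zero, integral_sub]
      · change _ = T ψ - T g
        rw [hTg, sub_zero]
      · exact hψi.1.sub hψi.2
      · exact hgi.1.sub hgi.2
      · intro x hx
        obtain ⟨a1, a2⟩ := hz g g3 x hx
        obtain ⟨a3, a4⟩ := hz ψ hs x hx
        simp [a1, a2, a3, a4]
    rw [hTd, hI, ← integral_mul_const, ← Real.norm_eq_abs]
    refine norm_integral_le_of_norm_le (hIi.mul_const _) (Filter.Eventually.of_forall fun x => ?_)
    have e : (V x (fderiv ℝ ψ x) - R x * ψ x) - (V x (fderiv ℝ g x) - R x * g x) =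
        -(V x (fderiv ℝ g x - fderiv ℝ ψ x)) + R x * (g x - ψ x) := by
      rw [map_sub]; ring
    rw [e]
    refine (norm_add_le _ _).trans ?_
    rw [norm_neg, norm_mul, add_mul, Real.norm_eq_abs (R x), Real.norm_eq_abs (g x - ψ x)]
    refine add_le_add (((V x).le_opNorm _).trans ?_) ?_
    · exact mul_le_mul_of_nonneg_left (g5 x) (norm_nonneg _)
    · exact mul_le_mul_of_nonneg_left (g4 x) (abs_nonneg _)
  have hT0 : T ψ = 0 := by
    by_contra hne
    have hp : 0 < |T ψ| := abs_pos.mpr hne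
    have := hTψ (|T ψ| / (2 * (I + 1))) (by positivity)
    have h2 : I * (|T ψ| / (2 * (I + 1))) = (I / (2 * (I + 1))) * |T ψ| := by ring
    have h3 : I / (2 * (I + 1)) < 1 := by
      rw [div_lt_one (by positivity)]; linarith
    rw [h2] at this
    nlinarith
  simp only [hT] at hT0
  rw [integral_sub hψi.1 hψi.2] at hT0
  linarith

/-- evaluation on the `i`-th standard basis vector -/
noncomputable def ev (n : ℕ) (i : Fin n) : DD n →L[ℝ] ℝ :=
  ContinuousLinearMap.apply ℝ ℝ (EuclideanSpace.single i (1 : ℝ))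

theorem ev_apply {n : ℕ} (i : Fin n) (p : DD n) : ev n i p = p (EuclideanSpace.single i 1) := rfl

noncomputable def cform (n : ℕ) (c : Fin n → Fin n → ℝ) : DD n →L[ℝ] DD n →L[ℝ] ℝ :=
  ∑ i, ∑ j, c i j • (ev n i).smulRight (ev n j)

theorem cform_apply {n : ℕ} (c : Fin n → Fin n → ℝ) (p q : DD n) :
    cform n c p q = ∑ i, ∑ j, c i j * p (EuclideanSpace.single i 1) *
      q (EuclideanSpace.single j 1) := by
  simp only [cform, ContinuousLinearMap.sum_apply, ContinuousLinearMap.smul_apply,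
    ContinuousLinearMap.smulRight_apply, smul_eq_mul, ev_apply, mul_assoc]

theorem norm_sq_dual {n : ℕ} (p : DD n) : ‖p‖ ^ 2 = ∑ i, p (EuclideanSpace.single i 1) ^ 2 := by
  have h := (InnerProductSpace.toDual ℝ (EE n)).symm.norm_map p
  rw [← h, EuclideanSpace.norm_sq_eq]
  refine Finset.sum_congr rfl fun i _ => ?_
  rw [Real.norm_eq_abs, sq_abs]
  congr 1
  have h1 := InnerProductSpace.toDual_symm_apply (𝕜 := ℝ) (x := EuclideanSpace.single i (1:ℝ)) (y := p)
  rw [← h1, EuclideanSpace.inner_single_right]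
  simp

theorem norm_gradient {n : ℕ} (φ : EE n → ℝ) (x : EE n) : ‖gradient φ x‖ = ‖fderiv ℝ φ x‖ :=
  (InnerProductSpace.toDual ℝ (EE n)).symm.norm_map _

theorem contDiff_cut_mul {n : ℕ} {k : WithTop ℕ∞} {χ g : EE n → ℝ} {U : Set (EE n)} (hU : IsOpen U)
    (hχ : ContDiff ℝ k χ) (hs : tsupport χ ⊆ U) (hg : ContDiffOn ℝ k g U) :
    ContDiff ℝ k (fun x => χ x * g x) := by
  rw [contDiff_iff_contDiffAt]
  intro x
  by_cases hx : x ∈ tsupport χ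
  · exact hχ.contDiffAt.mul (hg.contDiffAt (hU.mem_nhds (hs hx)))
  · have he : (fun x => χ x * g x) =ᶠ[nhds x] fun _ => 0 := by
      filter_upwards [(isClosed_tsupport χ).isOpen_compl.mem_nhds hx] with y hy
      rw [image_eq_zero_of_notMem_tsupport hy, zero_mul]
    exact contDiffAt_const.congr_of_eventuallyEq he

theorem continuous_cut_mul {n : ℕ} {χ g : EE n → ℝ} {U : Set (EE n)} (hU : IsOpen U)
    (hχ : Continuous χ) (hs : tsupport χ ⊆ U) (hg : ContinuousOn g U) :
    Continuous (fun x => χ x * g x) := by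
  rw [← contDiff_zero (𝕜 := ℝ)] at hχ ⊢
  exact contDiff_cut_mul hU hχ hs (contDiffOn_zero.mpr hg)

theorem integral_comp_aff {n : ℕ} (G : EE n → ℝ) (x₀ : EE n) {s : ℝ} (hs : 0 < s) :
    ∫ y, G (x₀ + s • y) = (s ^ n)⁻¹ * ∫ x, G x := by
  have h := Measure.integral_comp_smul (volume : Measure (EE n)) (fun z => G (x₀ + z)) s
  rw [h, integral_add_left_eq_self]
  simp only [finrank_euclideanSpace, Fintype.card_fin, smul_eq_mul]
  rw [abs_of_pos (by positivity)]

/-- the right-hand side -/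
noncomputable def rhs0 (n : ℕ) (ρ : EE n → ℝ → ℝ) (f : EE n → ℝ) (F : EE n → ℝ → EE n → ℝ)
    (φ : EE n → ℝ) (x : EE n) : ℝ :=
  ρ x (φ x) * (1 - (1/2) * f x * Real.exp (φ x) + F x (φ x) (gradient φ x))

theorem rhs0_bound {n : ℕ} {Λ κ : ℝ} (hκ : 1 ≤ κ)
    {a : Fin n → Fin n → EE n → ℝ → ℝ} {ρ : EE n → ℝ → ℝ} {f : EE n → ℝ}
    {F : EE n → ℝ → EE n → ℝ} (hg : GoodCoeffs n Λ a ρ f F) {φ : EE n → ℝ}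
    (hφ : IsSolution n κ a ρ f F φ) {x : EE n} (hx : x ∈ ball (0 : EE n) 1) :
    |rhs0 n ρ f F φ x| ≤ 2 * ‖fderiv ℝ φ x‖ ^ 2 + 2 * Real.exp κ := by
  obtain ⟨-, -, -, -, hρ, -, hf, -, hF⟩ := hg
  have h1 := hρ x hx (φ x)
  have h2 := hf x hx
  have h3 := hF x hx (φ x) (gradient φ x)
  rw [norm_gradient] at h3
  have h4 := hφ.2.1 x hx
  have h5 : Real.exp (φ x) ≤ Real.exp κ := Real.exp_le_exp.mpr h4.2
  have h6 : 2 ≤ Real.exp κ := by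
    have := Real.add_one_le_exp κ
    linarith
  have h7 := Real.exp_pos (φ x)
  rw [abs_le] at h3
  have h8 : 0 ≤ (1/2) * f x * Real.exp (φ x) := by have := h2.1; positivity
  have h9 : (1/2) * f x * Real.exp (φ x) ≤ (1/2) * Real.exp κ := by
    have : f x * Real.exp (φ x) ≤ 1 * Real.exp κ := mul_le_mul h2.2 h5 h7.le zero_le_one
    linarith
  have hN : 0 ≤ ‖fderiv ℝ φ x‖ ^ 2 := by positivity
  rw [rhs0, abs_mul, abs_of_nonneg (by linarith [h1.1] : 0 ≤ ρ x (φ x))]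
  have h10 : |1 - (1/2) * f x * Real.exp (φ x) + F x (φ x) (gradient φ x)| ≤
      ‖fderiv ℝ φ x‖ ^ 2 + Real.exp κ := by
    rw [abs_le]
    constructor <;> linarith [h3.1, h3.2]
  calc _ ≤ 2 * (‖fderiv ℝ φ x‖ ^ 2 + Real.exp κ) :=
        mul_le_mul h1.2 h10 (abs_nonneg _) (by norm_num)
    _ = _ := by ring

theorem rhs0_cont {n : ℕ} {Λ κ : ℝ}
    {a : Fin n → Fin n → EE n → ℝ → ℝ} {ρ : EE n → ℝ → ℝ} {f : EE n → ℝ}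
    {F : EE n → ℝ → EE n → ℝ} (hg : GoodCoeffs n Λ a ρ f F) {φ : EE n → ℝ}
    (hφ : IsSolution n κ a ρ f F φ) : ContinuousOn (rhs0 n ρ f F φ) (ball 0 1) := by
  obtain ⟨-, -, -, hρ, -, hf, -, hF, -⟩ := hg
  have hφc : ContinuousOn φ (ball 0 1) := hφ.1.continuousOn
  have hD : ContinuousOn (fun x => fderiv ℝ φ x) (ball 0 1) :=
    hφ.1.continuousOn_fderiv_of_isOpen isOpen_ball (by norm_num)
  have hgr : ContinuousOn (fun x => gradient φ x) (ball 0 1) :=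
    (InnerProductSpace.toDual ℝ (EE n)).symm.continuous.comp_continuousOn hD
  have c1 : ContinuousOn (fun x => ρ x (φ x)) (ball 0 1) :=
    hρ.comp (continuousOn_id.prodMk hφc) fun x hx => ⟨hx, mem_univ _⟩
  have c2 : ContinuousOn (fun x => F x (φ x) (gradient φ x)) (ball 0 1) :=
    hF.comp (continuousOn_id.prodMk (hφc.prodMk hgr)) fun x hx => ⟨hx, mem_univ _⟩
  exact c1.mul ((continuousOn_const.sub ((continuousOn_const.mul hf).mul hφc.rexp)).add c2)

theorem weak_rescale {n : ℕ} {κ : ℝ}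
    {a : Fin n → Fin n → EE n → ℝ → ℝ} {ρ : EE n → ℝ → ℝ} {f : EE n → ℝ}
    {F : EE n → ℝ → EE n → ℝ} {φ : EE n → ℝ}
    (hφ : IsSolution n κ a ρ f F φ) {x₀ : EE n} {s : ℝ} (hs : 0 < s)
    (hsub : ball x₀ s ⊆ ball (0 : EE n) 1) {ψ : EE n → ℝ} (h1 : ContDiff ℝ (⊤ : ℕ∞) ψ)
    (h2 : HasCompactSupport ψ) (h3 : tsupport ψ ⊆ ball 0 (7/8)) :
    ∫ y, s * cform n (fun i j => a i j (x₀ + s • y) (φ (x₀ + s • y)))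
        (fderiv ℝ φ (x₀ + s • y)) (fderiv ℝ ψ y) =
      ∫ y, s ^ 2 * rhs0 n ρ f F φ (x₀ + s • y) * ψ y := by
  have hs0 : s ≠ 0 := hs.ne'
  set T : EE n → EE n := fun x => s⁻¹ • (x - x₀) with hT
  have hTi : ∀ y, T (x₀ + s • y) = y := fun y => by
    simp only [hT, add_sub_cancel_left, smul_smul, inv_mul_cancel₀ hs0, one_smul]
  have hTi' : ∀ x, x₀ + s • T x = x := fun x => by
    simp only [hT, smul_smul, mul_inv_cancel₀ hs0, one_smul]; abel
  have hTc : Continuous T := by fun_prop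
  set Ψ : EE n → ℝ := fun x => ψ (T x) with hΨ
  have hΨC : ContDiff ℝ (⊤ : ℕ∞) Ψ :=
    h1.comp (by fun_prop : ContDiff ℝ (⊤ : ℕ∞) T)
  have hsupp : tsupport Ψ ⊆ (fun y => x₀ + s • y) '' tsupport ψ := by
    have hcl : IsClosed ((fun y => x₀ + s • y) '' tsupport ψ) :=
      (h2.isCompact.image (by fun_prop)).isClosed
    refine closure_minimal ?_ hcl
    intro x hx
    exact ⟨T x, subset_tsupport _ hx, hTi' x⟩
  have hΨc : HasCompactSupport Ψ :=
    (h2.isCompact.image (by fun_prop)).of_isClosed_subset (isClosed_tsupport _) hsupp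
  have hΨs : tsupport Ψ ⊆ ball 0 1 := by
    refine hsupp.trans ?_
    rintro x ⟨y, hy, rfl⟩
    apply hsub
    have := h3 hy
    rw [mem_ball_zero_iff] at this
    rw [mem_ball, dist_eq_norm, add_sub_cancel_left, norm_smul, Real.norm_eq_abs, abs_of_pos hs]
    nlinarith
  have hDΨ : ∀ y, fderiv ℝ Ψ (x₀ + s • y) = s⁻¹ • fderiv ℝ ψ y := by
    intro y
    have hTd : HasFDerivAt T (s⁻¹ • ContinuousLinearMap.id ℝ (EE n)) (x₀ + s • y) :=
      ((hasFDerivAt_id _).sub_const x₀).const_smul s⁻¹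
    have hd : HasFDerivAt ψ (fderiv ℝ ψ y) (T (x₀ + s • y)) := by
      rw [hTi]; exact ((h1.differentiable (by simp)) y).hasFDerivAt
    have := hd.comp (x₀ + s • y) hTd
    have h' : HasFDerivAt Ψ _ (x₀ + s • y) := this
    rw [h'.fderiv]
    ext v
    simp
  have key := hφ.2.2 Ψ hΨC hΨc hΨs
  rw [setIntegral_eq_integral_of_forall_compl_eq_zero,
    setIntegral_eq_integral_of_forall_compl_eq_zero] at key
  rotate_left
  · intro x hx
    have : Ψ x = 0 := image_eq_zero_of_notMem_tsupport fun h => hx (hΨs h)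
    rw [this, mul_zero]
  · intro x hx
    have : fderiv ℝ Ψ x = 0 := by
      by_contra h0
      exact hx (hΨs (support_fderiv_subset ℝ h0))
    simp [this]
  have k1 := integral_comp_aff (fun x => ∑ i : Fin n, ∑ j : Fin n,
          a i j x (φ x) * fderiv ℝ φ x (EuclideanSpace.single i 1) *
            fderiv ℝ Ψ x (EuclideanSpace.single j 1)) x₀ hs
  have k2 := integral_comp_aff (fun x =>
    ρ x (φ x) * (1 - (1/2) * f x * Real.exp (φ x) + F x (φ x) (gradient φ x)) * Ψ x) x₀ hs
  rw [key, ← k2] at k1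
  have k3 := congrArg (fun t => s ^ 2 * t) k1
  rw [← integral_const_mul, ← integral_const_mul] at k3
  convert k3 using 1
  · refine integral_congr_ae (Filter.Eventually.of_forall fun y => ?_)
    simp only
    rw [hDΨ, cform_apply, Finset.mul_sum, Finset.mul_sum]
    refine Finset.sum_congr rfl fun i _ => ?_
    rw [Finset.mul_sum, Finset.mul_sum]
    refine Finset.sum_congr rfl fun j _ => ?_
    simp only [ContinuousLinearMap.smul_apply, smul_eq_mul]
    field_simp
  · refine integral_congr_ae (Filter.Eventually.of_forall fun y => ?_)
    simp only [rhs0, hΨ, hTi]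
    ring

theorem step_dichotomy {n : ℕ} {Λ : ℝ} (hΛ : 1 ≤ Λ) {K : ℝ}
    (hK : ∀ b : EE n → DD n →L[ℝ] DD n →L[ℝ] ℝ, Ell n Λ b →
      ∀ w : EE n → ℝ, ContDiff ℝ 1 w → (∀ x, 0 ≤ w x) → ∀ δ : ℝ, 0 < δ → SuperSol n b w δ →
      ∀ h : ℝ, 0 ≤ h →
      volume (ball (0 : EE n) (3/4)) ≤ 2 * volume {x ∈ ball (0 : EE n) (3/4) | h ≤ w x} →
      ∀ x ∈ ball (0 : EE n) (1/2), Real.exp (-K) * h ≤ w x + δ)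
    {κ : ℝ} (hκ : 1 ≤ κ)
    {a : Fin n → Fin n → EE n → ℝ → ℝ} {ρ : EE n → ℝ → ℝ} {f : EE n → ℝ}
    {F : EE n → ℝ → EE n → ℝ} (hg : GoodCoeffs n Λ a ρ f F) {φ : EE n → ℝ}
    (hφ : IsSolution n κ a ρ f F φ) {x₀ : EE n} {s : ℝ} (hs : 0 < s)
    (hsub : ball x₀ s ⊆ ball (0 : EE n) 1) {m M : ℝ} (hm : ∀ x ∈ ball x₀ s, m ≤ φ x)
    (hM : ∀ x ∈ ball x₀ s, φ x ≤ M) (hmM : M - m ≤ κ) :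
    (∀ x ∈ ball x₀ (s/2), m + (1/2) * (Real.exp (-K) * Real.exp (-(Λ * κ))) * (M - m) -
      2 * Real.exp κ * s ^ 2 ≤ φ x) ∨
    (∀ x ∈ ball x₀ (s/2), φ x ≤ M - (1/2) * (Real.exp (-K) * Real.exp (-(Λ * κ))) * (M - m) +
      2 * Real.exp κ * s ^ 2) := by
  have hΛ0 : 0 < Λ := by linarith
  have hs0 : s ≠ 0 := hs.ne'
  set S : EE n → EE n := fun y => x₀ + s • y with hS
  have hSC : ContDiff ℝ 1 S := by fun_prop
  have hSball : ∀ y ∈ ball (0 : EE n) 1, S y ∈ ball x₀ s := by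
    intro y hy
    rw [mem_ball_zero_iff] at hy
    rw [mem_ball, dist_eq_norm, add_sub_cancel_left, norm_smul, Real.norm_eq_abs, abs_of_pos hs]
    nlinarith
  have hS1 : MapsTo S (ball (0 : EE n) 1) (ball 0 1) := fun y hy => hsub (hSball y hy)
  let χ : ContDiffBump (0 : EE n) := ⟨7/8, 15/16, by norm_num, by norm_num⟩
  have hχs : tsupport χ ⊆ ball (0 : EE n) 1 := by
    rw [χ.tsupport_eq]
    exact closedBall_subset_ball (by change (15/16 : ℝ) < 1; norm_num)
  have hχ1 : ∀ y ∈ ball (0 : EE n) (7/8), χ y = 1 := fun y hy =>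
    χ.one_of_mem_closedBall (ball_subset_closedBall hy)
  have hχz : ∀ y ∉ ball (0 : EE n) 1, χ y = 0 := fun y hy =>
    image_eq_zero_of_notMem_tsupport fun h => hy (hχs h)
  have hχ0 : ∀ y, 0 ≤ χ y := fun y => χ.nonneg
  have hχle : ∀ y, χ y ≤ 1 := fun y => χ.le_one
  have hφc : ContinuousOn φ (ball 0 1) := hφ.1.continuousOn
  -- the globalised solution
  set φt : EE n → ℝ := fun y => m + χ y * (φ (S y) - m) with hφt
  have hφtC : ContDiff ℝ 1 φt := by
    refine contDiff_const.add (contDiff_cut_mul isOpen_ball χ.contDiff hχs ?_)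
    exact (hφ.1.comp hSC.contDiffOn hS1).sub contDiffOn_const
  have hmM0 : m ≤ M := (hm x₀ (mem_ball_self hs)).trans (hM x₀ (mem_ball_self hs))
  have hφtm : ∀ y, m ≤ φt y := by
    intro y
    by_cases hy : y ∈ ball (0 : EE n) 1
    · have := mul_nonneg (hχ0 y) (sub_nonneg.mpr (hm _ (hSball y hy)))
      simp only [hφt]; linarith
    · simp [hφt, hχz y hy]
  have hφtM : ∀ y, φt y ≤ M := by
    intro y
    by_cases hy : y ∈ ball (0 : EE n) 1
    · have h1 := sub_nonneg.mpr (hm _ (hSball y hy))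
      have h2 := mul_le_mul_of_nonneg_right (hχle y) h1
      have h3 := hM _ (hSball y hy)
      simp only [hφt]; linarith
    · simp [hφt, hχz y hy, hmM0]
  have hφtv : ∀ y ∈ ball (0 : EE n) (7/8), φt y = φ (S y) := by
    intro y hy
    simp [hφt, hχ1 y hy]
  have hball78 : ball (0 : EE n) (7/8) ⊆ ball 0 1 := ball_subset_ball (by norm_num)
  have hφtD : ∀ y ∈ ball (0 : EE n) (7/8), fderiv ℝ φt y = s • fderiv ℝ φ (S y) := by
    intro y hy
    have he : φt =ᶠ[nhds y] fun z => φ (S z) := by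
      filter_upwards [isOpen_ball.mem_nhds hy] with z hz using hφtv z hz
    rw [he.fderiv_eq]
    have hd : HasFDerivAt φ (fderiv ℝ φ (S y)) (S y) :=
      ((hφ.1.differentiableOn (by norm_num)).differentiableAt
        (isOpen_ball.mem_nhds (hS1 (hball78 hy)))).hasFDerivAt
    have hSd : HasFDerivAt S (s • ContinuousLinearMap.id ℝ (EE n)) y :=
      ((hasFDerivAt_id y).const_smul s).const_add x₀
    have h' : HasFDerivAt (fun z => φ (S z)) _ y := hd.comp y hSd
    rw [h'.fderiv]
    ext v
    simp
  -- the globalised coefficients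
  set ct : EE n → Fin n → Fin n → ℝ := fun y i j =>
    χ y * a i j (S y) (φ (S y)) + (1 - χ y) * (if i = j then 1 else 0) with hct
  set bt : EE n → DD n →L[ℝ] DD n →L[ℝ] ℝ := fun y => cform n (ct y) with hbt
  have hctc : ∀ i j, Continuous (fun y => ct y i j) := by
    intro i j
    refine Continuous.add ?_ ((continuous_const.sub χ.continuous).mul continuous_const)
    refine continuous_cut_mul isOpen_ball χ.continuous hχs ?_
    refine (hg.1 i j).comp (hSC.continuous.continuousOn.prodMk
      (hφc.comp hSC.continuous.continuousOn hS1)) fun y hy => ⟨hS1 hy, mem_univ _⟩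
  have hbtc : Continuous bt := by
    simp only [hbt, cform]
    exact continuous_finset_sum _ fun i _ => continuous_finset_sum _ fun j _ =>
      (hctc i j).smul continuous_const
  have hdiag : ∀ y p, bt y p p = χ y * (∑ i, ∑ j, a i j (S y) (φ (S y)) *
      p (EuclideanSpace.single i 1) * p (EuclideanSpace.single j 1)) + (1 - χ y) * ‖p‖ ^ 2 := by
    intro y p
    rw [norm_sq_dual]
    simp only [hbt, cform_apply, hct, Finset.mul_sum, ← Finset.sum_add_distrib]
    refine Finset.sum_congr rfl fun i _ => ?_
    simp only [add_mul, Finset.sum_add_distrib]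
    congr 1
    · refine Finset.sum_congr rfl fun j _ => by ring
    · simp [sq, mul_assoc]
  have hell0 : ∀ y ∈ ball (0 : EE n) 1, ∀ p : DD n,
      Λ⁻¹ * ‖p‖ ^ 2 ≤ (∑ i, ∑ j, a i j (S y) (φ (S y)) *
      p (EuclideanSpace.single i 1) * p (EuclideanSpace.single j 1)) ∧
      (∑ i, ∑ j, a i j (S y) (φ (S y)) *
      p (EuclideanSpace.single i 1) * p (EuclideanSpace.single j 1)) ≤ Λ * ‖p‖ ^ 2 := by
    intro y hy p
    have h := hg.2.2.1 (S y) (hS1 hy) (φ (S y))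
      (WithLp.toLp 2 fun i => p (EuclideanSpace.single i 1))
    have hn : ‖(WithLp.toLp 2 fun i => p (EuclideanSpace.single i 1) : EE n)‖ ^ 2 = ‖p‖ ^ 2 := by
      rw [norm_sq_dual, EuclideanSpace.norm_sq_eq]
      simp
    rw [hn] at h
    exact h
  have hinv : Λ⁻¹ ≤ 1 := inv_le_one_of_one_le₀ hΛ
  have hEll : Ell n Λ bt := by
    refine ⟨hbtc, ?_, ?_, ?_⟩
    · intro y p q
      simp only [hbt, cform_apply]
      rw [Finset.sum_comm]
      refine Finset.sum_congr rfl fun i _ => Finset.sum_congr rfl fun j _ => ?_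
      have : ct y j i = ct y i j := by
        simp only [hct]
        rw [hg.2.1 j i]
        simp only [eq_comm]
      rw [this]; ring
    · intro y p
      rw [hdiag]
      have hN : 0 ≤ ‖p‖ ^ 2 := by positivity
      have h1 := mul_le_mul_of_nonneg_right hinv hN
      by_cases hy : y ∈ ball (0 : EE n) 1
      · have h2 := mul_le_mul_of_nonneg_left (hell0 y hy p).1 (hχ0 y)
        have h3 := mul_le_mul_of_nonneg_left h1 (sub_nonneg.mpr (hχle y))
        linarith
      · rw [hχz y hy]; linarith
    · intro y p
      rw [hdiag]
      have hN : 0 ≤ ‖p‖ ^ 2 := by positivity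
      have h1 := mul_le_mul_of_nonneg_right hΛ hN
      by_cases hy : y ∈ ball (0 : EE n) 1
      · have h2 := mul_le_mul_of_nonneg_left (hell0 y hy p).2 (hχ0 y)
        have h3 := mul_le_mul_of_nonneg_left h1 (sub_nonneg.mpr (hχle y))
        linarith
      · rw [hχz y hy]; linarith
  -- the globalised right-hand side
  set Rt : EE n → ℝ := fun y => χ y * (s ^ 2 * rhs0 n ρ f F φ (S y)) with hRt
  have hRtc : Continuous Rt :=
    continuous_cut_mul isOpen_ball χ.continuous hχs
      (continuousOn_const.mul ((rhs0_cont hg hφ).comp hSC.continuous.continuousOn hS1))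
  have hRb : ∀ y ∈ ball (0 : EE n) (7/8),
      |Rt y| ≤ 2 * ‖fderiv ℝ φt y‖ ^ 2 + 2 * Real.exp κ * s ^ 2 := by
    intro y hy
    have h := rhs0_bound hκ hg hφ (hS1 (hball78 hy))
    have h' := mul_le_mul_of_nonneg_left h (by positivity : 0 ≤ s ^ 2)
    rw [hφtD y hy, norm_smul, mul_pow, Real.norm_eq_abs, sq_abs]
    simp only [hRt, hχ1 y hy, one_mul, abs_mul, abs_of_nonneg (by positivity : 0 ≤ s ^ 2)]
    linarith
  have hweak : WeakEq n bt φt Rt := by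
    refine weakEq_of_smooth hbtc hφtC hRtc fun ψ h1 h2 h3 => ?_
    have key := weak_rescale hφ hs hsub h1 h2 h3
    convert key using 1
    · refine integral_congr_ae (Filter.Eventually.of_forall fun y => ?_)
      simp only
      by_cases hy : y ∈ ball (0 : EE n) (7/8)
      · rw [hφtD y hy]
        simp only [hbt, hct, hχ1 y hy, one_mul, sub_self, zero_mul, add_zero, map_smul,
          ContinuousLinearMap.smul_apply, smul_eq_mul, hS]
      · have : fderiv ℝ ψ y = 0 := by
          by_contra h0
          exact hy (h3 (support_fderiv_subset ℝ h0))
        rw [this, map_zero, map_zero, mul_zero]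
    · refine integral_congr_ae (Filter.Eventually.of_forall fun y => ?_)
      simp only
      by_cases hy : y ∈ ball (0 : EE n) (7/8)
      · simp only [hRt, hχ1 y hy, one_mul, hS]
      · have : ψ y = 0 := image_eq_zero_of_notMem_tsupport fun h => hy (h3 h)
        rw [this, mul_zero, mul_zero]
  have hpt : ∀ x ∈ ball x₀ (s/2), ∃ y ∈ ball (0 : EE n) (1/2), φt y = φ x := by
    intro x hx
    have hx' : S (s⁻¹ • (x - x₀)) = x := by
      simp only [hS, smul_smul, mul_inv_cancel₀ hs0, one_smul]; abel
    have hy : s⁻¹ • (x - x₀) ∈ ball (0 : EE n) (1/2) := by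
      rw [mem_ball, dist_eq_norm] at hx
      rw [mem_ball_zero_iff, norm_smul, norm_inv, Real.norm_eq_abs, abs_of_pos hs,
        inv_mul_lt_iff₀ hs]
      linarith
    refine ⟨_, hy, ?_⟩
    rw [hφtv _ (ball_subset_ball (by norm_num) hy), hx']
  have hD : 0 < 2 * Real.exp κ * s ^ 2 := by have := Real.exp_pos κ; positivity
  rcases osc_abs hΛ hK hEll hφtC hRtc hD hφtm hφtM hmM hRb hweak with h | h
  · left
    intro x hx
    obtain ⟨y, hy, he⟩ := hpt x hx
    rw [← he]; exact h y hy
  · right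
    intro x hx
    obtain ⟨y, hy, he⟩ := hpt x hx
    rw [← he]; exact h y hy

theorem osc_final {K Λ κ : ℝ} (hΛ : 1 ≤ Λ) (hκ : 1 ≤ κ) {w w' E : ℝ} (hw : 0 ≤ w)
    (h1 : w' ≤ w)
    (h2 : w' ≤ w - (1/2) * (Real.exp (-K) * Real.exp (-(Λ * κ))) * w + 2 * E) :
    w' ≤ ((8 * Real.exp K) * Real.exp (4 * Λ * κ) - 1) /
      ((8 * Real.exp K) * Real.exp (4 * Λ * κ) + 1) * w + E := by
  set X := (8 * Real.exp K) * Real.exp (4 * Λ * κ) with hX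
  have hX0 : 0 < X := by have := Real.exp_pos K; have := Real.exp_pos (4 * Λ * κ); positivity
  have hΛκ : 0 ≤ Λ * κ := by positivity
  set q := Real.exp (-K) * Real.exp (-(Λ * κ)) with hq
  have hqX : 8 ≤ q * X := by
    have : q * X = 8 * Real.exp (3 * (Λ * κ)) := by
      rw [hq, hX, show Real.exp (-K) * Real.exp (-(Λ * κ)) * (8 * Real.exp K * Real.exp (4 * Λ * κ))
        = 8 * (Real.exp (-K) * Real.exp (-(Λ * κ)) * Real.exp K * Real.exp (4 * Λ * κ)) by ring,
        ← Real.exp_add, ← Real.exp_add, ← Real.exp_add]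
      congr 2
      ring
    rw [this]
    have := Real.one_le_exp (by positivity : 0 ≤ 3 * (Λ * κ))
    linarith
  have hq0 : 0 < q := by positivity
  have h3 : (X - 1) / (X + 1) = 1 - 2 / (X + 1) := by
    field_simp; ring
  have h4 : 2 / (X + 1) ≤ (1/4) * q := by
    rw [div_le_iff₀ (by positivity)]
    nlinarith
  rw [h3]
  have h5 := mul_le_mul_of_nonneg_right h4 hw
  linarith

end Helpers

/-- **Oscillation decay** (the inequality following `(4.12)` in the proof of Theorem 4.2):
there is a constant `C ≥ 1` depending only on `n` and `Λ` such that for every solution `φ`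
and every ball `B_s(x₀) ⊆ B₁` with `s ∈ (0,1)`,
`osc_{B_{s/2}(x₀)} φ ≤ ((C e^{4Λκ} - 1)/(C e^{4Λκ} + 1)) osc_{B_s(x₀)} φ + e^κ s²`. -/
theorem oscillation_decay (n : ℕ) (hn : 2 ≤ n) (Λ : ℝ) (hΛ : 1 ≤ Λ) :
    ∃ C ≥ (1:ℝ),
      ∀ κ : ℝ, 1 ≤ κ →
      ∀ (a : Fin n → Fin n → EuclideanSpace ℝ (Fin n) → ℝ → ℝ)
        (ρ : EuclideanSpace ℝ (Fin n) → ℝ → ℝ)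
        (f : EuclideanSpace ℝ (Fin n) → ℝ)
        (F : EuclideanSpace ℝ (Fin n) → ℝ → EuclideanSpace ℝ (Fin n) → ℝ),
        GoodCoeffs n Λ a ρ f F →
        ∀ φ : EuclideanSpace ℝ (Fin n) → ℝ, IsSolution n κ a ρ f F φ →
        ∀ (x₀ : EuclideanSpace ℝ (Fin n)) (s : ℝ), s ∈ Set.Ioo (0:ℝ) 1 →
          ball x₀ s ⊆ ball (0 : EuclideanSpace ℝ (Fin n)) 1 →
          sSup (φ '' ball x₀ (s/2)) - sInf (φ '' ball x₀ (s/2)) ≤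
            ((C * Real.exp (4 * Λ * κ) - 1) / (C * Real.exp (4 * Λ * κ) + 1)) *
              (sSup (φ '' ball x₀ s) - sInf (φ '' ball x₀ s))
            + Real.exp κ * s ^ 2 := by
  obtain ⟨K, hK1, hK⟩ := growth_lemma n hn Λ hΛ
  refine ⟨8 * Real.exp K, ?_, ?_⟩
  · have := Real.one_le_exp (by linarith : 0 ≤ K)
    linarith
  intro κ hκ a ρ f F hg φ hφ x₀ s hs hsub
  have hs0 : 0 < s := hs.1
  have hhalf : ball x₀ (s/2) ⊆ ball x₀ s := ball_subset_ball (by linarith)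
  have hbd : ∀ x ∈ ball x₀ s, 0 ≤ φ x ∧ φ x ≤ κ := fun x hx => hφ.2.1 x (hsub hx)
  have hba : BddAbove (φ '' ball x₀ s) := ⟨κ, by rintro _ ⟨x, hx, rfl⟩; exact (hbd x hx).2⟩
  have hbb : BddBelow (φ '' ball x₀ s) := ⟨0, by rintro _ ⟨x, hx, rfl⟩; exact (hbd x hx).1⟩
  have hne : (φ '' ball x₀ s).Nonempty := ⟨φ x₀, x₀, mem_ball_self hs0, rfl⟩
  have hne' : (φ '' ball x₀ (s/2)).Nonempty := ⟨φ x₀, x₀, mem_ball_self (by linarith), rfl⟩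
  set M := sSup (φ '' ball x₀ s) with hMdef
  set m := sInf (φ '' ball x₀ s) with hmdef
  have hm : ∀ x ∈ ball x₀ s, m ≤ φ x := fun x hx => csInf_le hbb ⟨x, hx, rfl⟩
  have hM : ∀ x ∈ ball x₀ s, φ x ≤ M := fun x hx => le_csSup hba ⟨x, hx, rfl⟩
  have hM1 : M ≤ κ := csSup_le hne (by rintro _ ⟨x, hx, rfl⟩; exact (hbd x hx).2)
  have hm0 : 0 ≤ m := le_csInf hne (by rintro _ ⟨x, hx, rfl⟩; exact (hbd x hx).1)
  have hmM : m ≤ M := (hm x₀ (mem_ball_self hs0)).trans (hM x₀ (mem_ball_self hs0))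
  have hM' : sSup (φ '' ball x₀ (s/2)) ≤ M := csSup_le_csSup hba hne' (image_mono hhalf)
  have hm' : m ≤ sInf (φ '' ball x₀ (s/2)) := csInf_le_csInf hbb hne' (image_mono hhalf)
  refine osc_final hΛ hκ (by linarith) (by linarith) ?_
  rcases step_dichotomy hΛ hK hκ hg hφ hs0 hsub hm hM (by linarith) with h | h
  · have h3 := le_csInf hne' (by rintro _ ⟨x, hx, rfl⟩; exact h x hx)
    linarith
  · have h3 := csSup_le hne' (by rintro _ ⟨x, hx, rfl⟩; exact h x hx)
    linarith
end

section
/- Define ξ(t) = (1/(2Λ))(e^{2Λt} − 1), so that ξ'' = 2Λ ξ', ξ(0) = 0 and ξ'(0) = 1. Let φ be a solution, let x₀ and s ∈ (0,1) be such that B_s(x₀) ⊆ B₁, and set v = φ − inf_{B_s(x₀)} φ. Then ξ(v) is a weak subsolution of the associated linear equation: for every nonnegative ψ ∈ C_c^∞(B_s(x₀)), ∫_{B_s(x₀)} Σ_{i,j} a_{ij}(x, φ(x)) ∂ᵢ(ξ(v))(x) ∂ⱼψ(x) dx ≤ ∫_{B_s(x₀)} 4 ξ'(v(x)) ψ(x)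 dx. -/
open MeasureTheory Metric Real Set

open Filter Topology Convolution ContinuousLinearMap

section Helpers

variable {n : ℕ}

lemma aux_integrableOn {U : Set (EuclideanSpace ℝ (Fin n))} (hU : IsOpen U)
    {b g : EuclideanSpace ℝ (Fin n) → ℝ} (hb : ContinuousOn b U) (hg : Continuous g)
    {K : Set (EuclideanSpace ℝ (Fin n))} (hK : IsCompact K) (hKU : K ⊆ U)
    (hgK : ∀ x, x ∉ K → g x = 0) :
    IntegrableOn (fun x => b x * g x) U := by
  have h1 : IntegrableOn (fun x => b x * g x) K :=
    ((hb.mono hKU).mul hg.continuousOn).integrableOn_compact hK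
  refine h1.of_forall_sdiff_eq_zero hU.measurableSet ?_
  intro x hx
  simp [hgK x hx.2]

lemma aux_conv_zero {K : Set (EuclideanSpace ℝ (Fin n))} {δ : ℝ}
    (β : ContDiffBump (0 : EuclideanSpace ℝ (Fin n))) (hβ : β.rOut ≤ δ)
    {g : EuclideanSpace ℝ (Fin n) → ℝ} (hgK : ∀ x, x ∉ K → g x = 0)
    (x : EuclideanSpace ℝ (Fin n)) (hx : x ∉ cthickening δ K) :
    (β.normed volume ⋆[lsmul ℝ ℝ, volume] g) x = 0 := by
  by_contra h
  have h1 := support_convolution_subset (lsmul ℝ ℝ) (μ := volume) (f := β.normed volume) (g := g) h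
  obtain ⟨y, hy, z, hz, rfl⟩ := Set.mem_add.1 h1
  apply hx
  have hzK : z ∈ K := by
    by_contra hz'
    exact hz (hgK z hz')
  rw [β.support_normed_eq] at hy
  refine mem_cthickening_of_dist_le (y + z) z δ K hzK ?_
  have : ‖y‖ < β.rOut := by simpa using hy
  simp [dist_eq_norm]
  linarith

lemma aux_conv_cont (β : ContDiffBump (0 : EuclideanSpace ℝ (Fin n)))
    {g : EuclideanSpace ℝ (Fin n) → ℝ} (hg : Continuous g) :
    ContDiff ℝ (⊤ : ℕ∞) (β.normed volume ⋆[lsmul ℝ ℝ, volume] g) :=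
  β.hasCompactSupport_normed.contDiff_convolution_left _ β.contDiff_normed hg.locallyIntegrable

lemma aux_conv_bound (β : ContDiffBump (0 : EuclideanSpace ℝ (Fin n)))
    {g : EuclideanSpace ℝ (Fin n) → ℝ} (hg : Continuous g) {M : ℝ} (hM : ∀ x, ‖g x‖ ≤ M)
    (x : EuclideanSpace ℝ (Fin n)) :
    ‖(β.normed volume ⋆[lsmul ℝ ℝ, volume] g) x‖ ≤ 3 * M := by
  have h := ContDiffBump.dist_normed_convolution_le (φ := β) (μ := volume) (x₀ := x) (ε := 2 * M)
    hg.aestronglyMeasurable (fun y _ => by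
      rw [dist_eq_norm]
      have := norm_sub_le (g y) (g x)
      linarith [hM x, hM y])
  rw [dist_eq_norm] at h
  have h2 := norm_le_norm_add_norm_sub' ((β.normed volume ⋆[lsmul ℝ ℝ, volume] g) x) (g x)
  linarith [hM x]

lemma aux_tendsto {U : Set (EuclideanSpace ℝ (Fin n))} (hU : IsOpen U)
    {b g : EuclideanSpace ℝ (Fin n) → ℝ} (hb : ContinuousOn b U) (hg : Continuous g)
    {K : Set (EuclideanSpace ℝ (Fin n))} (hK : IsCompact K) {δ : ℝ}
    (hKU : cthickening δ K ⊆ U)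
    (hgK : ∀ x, x ∉ K → g x = 0) (β : ℕ → ContDiffBump (0 : EuclideanSpace ℝ (Fin n)))
    (hβ : ∀ k, (β k).rOut ≤ δ) (hβ0 : Tendsto (fun k => (β k).rOut) atTop (𝓝 0)) :
    Tendsto (fun k => ∫ x in U, b x * ((β k).normed volume ⋆[lsmul ℝ ℝ, volume] g) x) atTop
      (𝓝 (∫ x in U, b x * g x)) := by
  have hK' : IsCompact (cthickening δ K) := hK.cthickening
  obtain ⟨C, hC⟩ := hK'.exists_bound_of_continuousOn (hb.mono hKU)
  obtain ⟨M, hM⟩ := (HasCompactSupport.intro hK hgK).exists_bound_of_continuous hg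
  have hM0 : 0 ≤ M := (norm_nonneg _).trans (hM 0)
  refine tendsto_integral_of_dominated_convergence
    ((cthickening δ K).indicator (fun _ => C * (3 * M))) ?_ ?_ ?_ ?_
  · intro k
    exact (hb.mul (aux_conv_cont (β k) hg).continuous.continuousOn).aestronglyMeasurable
      hU.measurableSet
  · refine Integrable.integrableOn ?_
    rw [integrable_indicator_iff hK'.measurableSet]
    exact integrableOn_const hK'.measure_lt_top.ne
  · intro k
    refine Eventually.of_forall fun x => ?_
    by_cases hx : x ∈ cthickening δ K
    · rw [indicator_of_mem hx, norm_mul]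
      have h1 := hC x hx
      exact mul_le_mul h1 (aux_conv_bound (β k) hg hM x) (norm_nonneg _)
        ((norm_nonneg _).trans h1)
    · rw [aux_conv_zero (β k) (hβ k) hgK x hx, indicator_of_notMem hx]
      simp
  · refine Eventually.of_forall fun x => ?_
    exact (ContDiffBump.convolution_tendsto_right_of_continuous hβ0 hg x).const_mul (b x)

/-- Extension of the weak formulation from smooth to `C¹` test functions. -/
lemma aux_extend {U : Set (EuclideanSpace ℝ (Fin n))} (hU : IsOpen U)
    {A : Fin n → EuclideanSpace ℝ (Fin n) → ℝ} {B : EuclideanSpace ℝ (Fin n) → ℝ}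
    (hA : ∀ j, ContinuousOn (A j) U) (hB : ContinuousOn B U)
    (H : ∀ ψ : EuclideanSpace ℝ (Fin n) → ℝ,
      ContDiff ℝ (⊤ : ℕ∞) ψ → HasCompactSupport ψ → tsupport ψ ⊆ U →
      (∫ x in U, ∑ j, A j x * fderiv ℝ ψ x (EuclideanSpace.single j 1)) = ∫ x in U, B x * ψ x)
    {η : EuclideanSpace ℝ (Fin n) → ℝ} (hη : ContDiff ℝ 1 η) (hηc : HasCompactSupport η)
    (hηU : tsupport η ⊆ U) :
    (∫ x in U, ∑ j, A j x * fderiv ℝ η x (EuclideanSpace.single j 1)) = ∫ x in U, B x * η x := by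
  have hK : IsCompact (tsupport η) := hηc
  obtain ⟨δ, hδ, hδU⟩ := hK.exists_cthickening_subset_open hU hηU
  let β : ℕ → ContDiffBump (0 : EuclideanSpace ℝ (Fin n)) := fun k =>
    ⟨δ / (k + 1) / 2, δ / (k + 1), by positivity, half_lt_self (by positivity)⟩
  have hβr : ∀ k, (β k).rOut = δ / (k + 1) := fun k => rfl
  have hβ : ∀ k, (β k).rOut ≤ δ := fun k => by
    rw [hβr]
    exact div_le_self hδ.le (by linarith [(Nat.cast_nonneg k : (0:ℝ) ≤ k)])
  have hβ0 : Tendsto (fun k => (β k).rOut) atTop (𝓝 0) := by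
    simp_rw [hβr]
    have := (tendsto_one_div_add_atTop_nhds_zero_nat (𝕜 := ℝ)).const_mul δ
    simpa [div_eq_mul_inv] using this
  have hK' : IsCompact (cthickening δ (tsupport η)) := hK.cthickening
  have hη0 : ∀ x, x ∉ tsupport η → η x = 0 := fun x hx => image_eq_zero_of_notMem_tsupport hx
  have hd : ∀ j : Fin n, Continuous fun x => fderiv ℝ η x (EuclideanSpace.single j 1) := fun j =>
    (hη.continuous_fderiv one_ne_zero).clm_apply continuous_const
  have hd0 : ∀ (j : Fin n) x, x ∉ tsupport η → fderiv ℝ η x (EuclideanSpace.single j 1) = 0 := by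
    intro j x hx
    have : fderiv ℝ η x = 0 := by
      by_contra h
      exact hx (support_fderiv_subset ℝ h)
    simp [this]
  have hfd : ∀ k j x, fderiv ℝ ((β k).normed volume ⋆[lsmul ℝ ℝ, volume] η) x
      (EuclideanSpace.single j 1) = ((β k).normed volume ⋆[lsmul ℝ ℝ, volume]
        (fun x => fderiv ℝ η x (EuclideanSpace.single j 1))) x := by
    intro k j x
    have hli : LocallyIntegrable ((β k).normed volume)
      (volume : Measure (EuclideanSpace ℝ (Fin n))) := (β k).continuous_normed.locallyIntegrable
    rw [(hηc.hasFDerivAt_convolution_right (lsmul ℝ ℝ) hli hη x).fderiv]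
    exact convolution_precompR_apply (lsmul ℝ ℝ) hli (hηc.fderiv ℝ)
      (hη.continuous_fderiv one_ne_zero) x _
  have hkey : ∀ k, (∑ j, ∫ x in U, A j x * ((β k).normed volume ⋆[lsmul ℝ ℝ, volume]
        (fun x => fderiv ℝ η x (EuclideanSpace.single j 1))) x)
      = ∫ x in U, B x * ((β k).normed volume ⋆[lsmul ℝ ℝ, volume] η) x := by
    intro k
    have hz := aux_conv_zero (β k) (hβ k) hη0
    have hts : tsupport ((β k).normed volume ⋆[lsmul ℝ ℝ, volume] η)
        ⊆ cthickening δ (tsupport η) := by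
      refine closure_minimal ?_ isClosed_cthickening
      intro x hx
      by_contra h
      exact hx (hz x h)
    rw [← H _ (aux_conv_cont (β k) hη.continuous) (HasCompactSupport.intro hK' hz)
      (hts.trans hδU), ← integral_finsetSum]
    · simp_rw [hfd]
    · intro j _
      exact aux_integrableOn hU (hA j) (aux_conv_cont (β k) (hd j)).continuous hK' hδU
        (aux_conv_zero (β k) (hβ k) (hd0 j))
  have hl1 := tendsto_finsetSum Finset.univ fun j _ =>
    aux_tendsto hU (hA j) (hd j) hK hδU (hd0 j) β hβ hβ0
  have hl2 := aux_tendsto hU hB hη.continuous hK hδU hη0 β hβ hβ0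
  simp_rw [hkey] at hl1
  rw [← tendsto_nhds_unique hl1 hl2, integral_finsetSum]
  intro j _
  exact aux_integrableOn hU (hA j) (hd j) hK hηU (hd0 j)

end Helpers

/-- **`ξ(v)` is a weak subsolution** (from the proof of Theorem 4.2):
with `ξ(t) = (1/(2Λ))(e^{2Λt} - 1)` (so `ξ'' = 2Λξ'`, `ξ(0) = 0`, `ξ'(0) = 1`,
`ξ'(t) = e^{2Λt}`), for any solution `φ`, any ball `B_s(x₀) ⊆ B₁` with `s ∈ (0,1)`,
and `v = φ - inf_{B_s(x₀)} φ`, one has, for every nonnegative `ψ ∈ C_c^∞(B_s(x₀))`,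
`∫ aᵢⱼ(x,φ) ∂ᵢ(ξ(v)) ∂ⱼψ ≤ ∫ 4 ξ'(v) ψ`. -/
theorem xi_of_v_weak_subsolution (n : ℕ) (hn : 2 ≤ n) (Λ κ : ℝ) (hΛ : 1 ≤ Λ) (hκ : 1 ≤ κ)
    (a : Fin n → Fin n → EuclideanSpace ℝ (Fin n) → ℝ → ℝ)
    (ρ : EuclideanSpace ℝ (Fin n) → ℝ → ℝ)
    (f : EuclideanSpace ℝ (Fin n) → ℝ)
    (F : EuclideanSpace ℝ (Fin n) → ℝ → EuclideanSpace ℝ (Fin n) → ℝ)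
    (hcoeff : GoodCoeffs n Λ a ρ f F)
    (φ : EuclideanSpace ℝ (Fin n) → ℝ) (hφ : IsSolution n κ a ρ f F φ)
    (x₀ : EuclideanSpace ℝ (Fin n)) (s : ℝ) (hs : s ∈ Set.Ioo (0:ℝ) 1)
    (hball : ball x₀ s ⊆ ball (0 : EuclideanSpace ℝ (Fin n)) 1)
    (ψ : EuclideanSpace ℝ (Fin n) → ℝ) (hψ : ContDiff ℝ (⊤ : ℕ∞) ψ)
    (hψc : HasCompactSupport ψ) (hψs : tsupport ψ ⊆ ball x₀ s)
    (hψ0 : ∀ x, 0 ≤ ψ x) :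
    (∫ x in ball x₀ s,
        ∑ i : Fin n, ∑ j : Fin n,
          a i j x (φ x) *
            fderiv ℝ
              (fun y => (1 / (2 * Λ)) *
                (Real.exp (2 * Λ * (φ y - sInf (φ '' ball x₀ s))) - 1)) x
              (EuclideanSpace.single i 1) *
            fderiv ℝ ψ x (EuclideanSpace.single j 1))
      ≤ ∫ x in ball x₀ s,
          4 * Real.exp (2 * Λ * (φ x - sInf (φ '' ball x₀ s))) * ψ x := by
  obtain ⟨ha, -, hell, hρ, hρb, hf, hfb, hF, hFb⟩ := hcoeff
  obtain ⟨hφ1, -, hweak⟩ := hφ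
  set U := ball (0 : EuclideanSpace ℝ (Fin n)) 1 with hUdef
  have hU : IsOpen U := isOpen_ball
  set m := sInf (φ '' ball x₀ s)
  have hΛ0 : (0:ℝ) < Λ := by linarith
  have hφd : ∀ x ∈ U, HasFDerivAt φ (fderiv ℝ φ x) x := fun x hx =>
    ((hφ1.differentiableOn one_ne_zero).differentiableAt (hU.mem_nhds hx)).hasFDerivAt
  have hφc : ContinuousOn φ U := hφ1.continuousOn
  have hdφ : ContinuousOn (fderiv ℝ φ) U := hφ1.continuousOn_fderiv_of_isOpen hU le_rfl
  have hdφi : ∀ i : Fin n, ContinuousOn (fun x => fderiv ℝ φ x (EuclideanSpace.single i 1)) U :=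
    fun i => hdφ.clm_apply continuousOn_const
  have hgrad : ContinuousOn (fun x => gradient φ x) U := by
    unfold gradient
    exact (LinearIsometryEquiv.continuous _).comp_continuousOn hdφ
  have hgi : ∀ x (i : Fin n), gradient φ x i = fderiv ℝ φ x (EuclideanSpace.single i 1) := by
    intro x i
    have h1 : inner ℝ (gradient φ x) (EuclideanSpace.single i (1:ℝ))
        = fderiv ℝ φ x (EuclideanSpace.single i 1) := by
      unfold gradient
      exact InnerProductSpace.toDual_symm_apply
    rw [← h1, EuclideanSpace.inner_single_right]
    simp
  have hac : ∀ i j, ContinuousOn (fun x => a i j x (φ x)) U := fun i j =>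
    (ha i j).comp (continuousOn_id.prodMk hφc) (fun x hx => ⟨hx, mem_univ _⟩)
  have hρc : ContinuousOn (fun x => ρ x (φ x)) U :=
    hρ.comp (continuousOn_id.prodMk hφc) (fun x hx => ⟨hx, mem_univ _⟩)
  have hFc : ContinuousOn (fun x => F x (φ x) (gradient φ x)) U :=
    hF.comp (continuousOn_id.prodMk (hφc.prodMk hgrad)) (fun x hx => ⟨hx, mem_univ _⟩)
  let A : Fin n → EuclideanSpace ℝ (Fin n) → ℝ := fun j x =>
    ∑ i, a i j x (φ x) * fderiv ℝ φ x (EuclideanSpace.single i 1)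
  let B : EuclideanSpace ℝ (Fin n) → ℝ := fun x =>
    ρ x (φ x) * (1 - (1/2) * f x * Real.exp (φ x) + F x (φ x) (gradient φ x))
  have hA : ∀ j, ContinuousOn (A j) U := fun j =>
    continuousOn_finsetSum _ fun i _ => (hac i j).mul (hdφi i)
  have hB : ContinuousOn B U :=
    hρc.mul ((continuousOn_const.sub ((continuousOn_const.mul hf).mul hφc.rexp)).add hFc)
  have hswap : ∀ (x : EuclideanSpace ℝ (Fin n)) (w : Fin n → ℝ),
      ∑ i, ∑ j, a i j x (φ x) * fderiv ℝ φ x (EuclideanSpace.single i 1) * w j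
        = ∑ j, A j x * w j := by
    intro x w
    rw [Finset.sum_comm]
    simp only [A, Finset.sum_mul]
  let e : EuclideanSpace ℝ (Fin n) → ℝ := fun x => Real.exp (2 * Λ * (φ x - m))
  have he : ContDiffOn ℝ 1 e U := (contDiffOn_const.mul (hφ1.sub contDiffOn_const)).exp
  have hed : ∀ x ∈ U, HasFDerivAt e ((2 * Λ * e x) • fderiv ℝ φ x) x := by
    intro x hx
    have := (((hφd x hx).sub_const m).const_mul (2 * Λ)).exp
    rw [smul_smul, mul_comm (Real.exp _)] at this
    exact this
  let η : EuclideanSpace ℝ (Fin n) → ℝ := fun x => e x * ψ x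
  have hψU : tsupport ψ ⊆ U := hψs.trans hball
  have hψ1 : ContDiff ℝ 1 ψ := hψ.of_le (by exact_mod_cast le_top)
  have hη : ContDiff ℝ 1 η := by
    rw [contDiff_iff_contDiffAt]
    intro x
    by_cases hx : x ∈ tsupport ψ
    · exact (he.contDiffAt (hU.mem_nhds (hψU hx))).mul hψ1.contDiffAt
    · have h0 : η =ᶠ[𝓝 x] fun _ => 0 := by
        filter_upwards [notMem_tsupport_iff_eventuallyEq.1 hx] with y hy
        simp [η, hy]
      exact contDiffAt_const.congr_of_eventuallyEq h0
  have hψz : ∀ x, x ∉ tsupport ψ → ψ x = 0 := fun x hx => image_eq_zero_of_notMem_tsupport hx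
  have hηz : ∀ x, x ∉ tsupport ψ → η x = 0 := fun x hx => by simp [η, hψz x hx]
  have hηc : HasCompactSupport η := HasCompactSupport.intro hψc hηz
  have hηs : tsupport η ⊆ tsupport ψ := by
    refine closure_minimal ?_ (isClosed_tsupport ψ)
    intro x hx
    by_contra h
    exact hx (hηz x h)
  have hmain := aux_extend hU hA hB (fun ψ h1 h2 h3 => by
    have h := hweak ψ h1 h2 h3
    simp_rw [hswap] at h
    exact h) hη hηc (hηs.trans hψU)
  have hdη : ∀ x ∈ U, ∀ v, fderiv ℝ η x v
      = e x * fderiv ℝ ψ x v + 2 * Λ * fderiv ℝ φ x v * η x := by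
    intro x hx v
    have := ((hed x hx).mul (hψ1.differentiable one_ne_zero x).hasFDerivAt).fderiv
    change fderiv ℝ η x = _ at this
    rw [this]
    simp [η]; ring
  have hdz : ∀ x, x ∉ tsupport ψ → fderiv ℝ ψ x = 0 := by
    intro x hx
    by_contra h
    exact hx (support_fderiv_subset ℝ h)
  -- the quadratic form
  let Q : EuclideanSpace ℝ (Fin n) → ℝ := fun x =>
    ∑ j, A j x * fderiv ℝ φ x (EuclideanSpace.single j 1)
  have hQ : ContinuousOn Q U := continuousOn_finsetSum _ fun j _ => (hA j).mul (hdφi j)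
  have hQge : ∀ x ∈ U, Λ⁻¹ * ‖gradient φ x‖ ^ 2 ≤ Q x := by
    intro x hx
    have := (hell x hx (φ x) (gradient φ x)).1
    simp_rw [hgi, hswap] at this
    exact this
  have hLHS : (∫ x in ball x₀ s,
        ∑ i : Fin n, ∑ j : Fin n,
          a i j x (φ x) *
            fderiv ℝ (fun y => (1 / (2 * Λ)) * (Real.exp (2 * Λ * (φ y - m)) - 1)) x
              (EuclideanSpace.single i 1) *
            fderiv ℝ ψ x (EuclideanSpace.single j 1))
      = ∫ x in ball x₀ s, (∑ j, A j x * fderiv ℝ η x (EuclideanSpace.single j 1)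
          - 2 * Λ * Q x * η x) := by
    refine setIntegral_congr_fun measurableSet_ball ?_
    intro x hx
    have hxU := hball hx
    have h1 : fderiv ℝ (fun y => (1 / (2 * Λ)) * (Real.exp (2 * Λ * (φ y - m)) - 1)) x
        = e x • fderiv ℝ φ x := by
      have := (((hed x hxU).sub_const 1).const_mul (1 / (2 * Λ))).fderiv
      refine this.trans ?_
      rw [smul_smul]
      congr 1
      field_simp
    simp only [h1, hdη x hxU]
    have h2 : ∀ i j, a i j x (φ x) * (e x • fderiv ℝ φ x) (EuclideanSpace.single i 1) *
        fderiv ℝ ψ x (EuclideanSpace.single j 1)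
        = a i j x (φ x) * fderiv ℝ φ x (EuclideanSpace.single i 1) *
          (e x * fderiv ℝ ψ x (EuclideanSpace.single j 1)) := by
      intro i j
      simp only [ContinuousLinearMap.smul_apply, smul_eq_mul]; ring
    simp_rw [h2, hswap, mul_add, Finset.sum_add_distrib]
    simp only [Q, Finset.mul_sum, Finset.sum_mul]
    rw [eq_sub_iff_add_eq]
    congr 1
    exact Finset.sum_congr rfl fun j _ => by ring
  have hdηz : ∀ x, x ∉ tsupport ψ → fderiv ℝ η x = 0 := by
    intro x hx
    by_contra h
    exact hx (hηs (support_fderiv_subset ℝ h))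
  have hext1 : (∫ x in ball x₀ s, (∑ j, A j x * fderiv ℝ η x (EuclideanSpace.single j 1)
          - 2 * Λ * Q x * η x)) = ∫ x in U, (∑ j, A j x * fderiv ℝ η x (EuclideanSpace.single j 1)
          - 2 * Λ * Q x * η x) := by
    refine (setIntegral_eq_of_subset_of_forall_sdiff_eq_zero hU.measurableSet hball ?_).symm
    intro x hx
    have hx' : x ∉ tsupport ψ := fun h => hx.2 (hψs h)
    simp [hdηz x hx', hηz x hx']
  have hext2 : (∫ x in ball x₀ s, 4 * Real.exp (2 * Λ * (φ x - m)) * ψ x)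
      = ∫ x in U, 4 * η x := by
    have : ∀ x, 4 * Real.exp (2 * Λ * (φ x - m)) * ψ x = 4 * η x := fun x => by
      simp only [η, e]; ring
    simp_rw [this]
    refine (setIntegral_eq_of_subset_of_forall_sdiff_eq_zero hU.measurableSet hball ?_).symm
    intro x hx
    have hx' : x ∉ tsupport ψ := fun h => hx.2 (hψs h)
    simp [hηz x hx']
  have hiT : IntegrableOn (fun x => ∑ j, A j x * fderiv ℝ η x (EuclideanSpace.single j 1)) U := by
    refine integrable_finsetSum _ fun j _ => ?_
    exact aux_integrableOn hU (hA j)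
      ((hη.continuous_fderiv one_ne_zero).clm_apply continuous_const) hψc hψU
      (fun x hx => by simp [hdηz x hx])
  have hiS : IntegrableOn (fun x => 2 * Λ * Q x * η x) U :=
    aux_integrableOn hU (continuousOn_const.mul hQ) hη.continuous hψc hψU hηz
  have hiB : IntegrableOn (fun x => B x * η x) U :=
    aux_integrableOn hU hB hη.continuous hψc hψU hηz
  have hiR : IntegrableOn (fun x => 4 * η x) U :=
    aux_integrableOn hU continuousOn_const hη.continuous hψc hψU hηz
  rw [hLHS, hext1, hext2, integral_sub hiT hiS, hmain, ← integral_sub hiB hiS]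
  refine setIntegral_mono_on (hiB.sub hiS) hiR hU.measurableSet ?_
  intro x hx
  have hη0 : 0 ≤ η x := mul_nonneg (Real.exp_pos _).le (hψ0 x)
  have h1 : 2 * ‖gradient φ x‖ ^ 2 ≤ 2 * Λ * Q x := by
    have := mul_le_mul_of_nonneg_left (hQge x hx) (by positivity : 0 ≤ 2 * Λ)
    rwa [show 2 * Λ * (Λ⁻¹ * ‖gradient φ x‖ ^ 2) = 2 * ‖gradient φ x‖ ^ 2 by field_simp] at this
  have h2 : B x ≤ 4 + 2 * ‖gradient φ x‖ ^ 2 := by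
    have hr := hρb x hx (φ x)
    have h3 : 1 - (1/2) * f x * Real.exp (φ x) + F x (φ x) (gradient φ x)
        ≤ 2 + ‖gradient φ x‖ ^ 2 := by
      have h4 := (abs_le.1 (hFb x hx (φ x) (gradient φ x))).2
      have h5 : 0 ≤ (1/2) * f x * Real.exp (φ x) :=
        mul_nonneg (mul_nonneg (by norm_num) (hfb x hx).1) (Real.exp_pos _).le
      linarith
    calc B x ≤ ρ x (φ x) * (2 + ‖gradient φ x‖ ^ 2) :=
          mul_le_mul_of_nonneg_left h3 (by linarith [hr.1])
      _ ≤ 2 * (2 + ‖gradient φ x‖ ^ 2) := mul_le_mul_of_nonneg_right hr.2 (by positivity)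
      _ = _ := by ring
  have h3 : (B x - 2 * Λ * Q x) * η x ≤ 4 * η x :=
    mul_le_mul_of_nonneg_right (by linarith) hη0
  linarith
end
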